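/- arXiv:1702.03356 — 11 statements merged into one kernel-verified Lean document; each statement's English description precedes it below -/
import Mathlib

section
/- Let R be a semilocal ring and M a left R-module. Then the following are equivalent: (1) the action of the group of units Rˣ on M by scalar multiplication has finitely many orbits; (2) M has only finitely many submodules; (3) M has finite length and there do not exist submodules N ≤ N' of M and a simple left R-module T with infinite endomorphism ring such that N'/N is isomorphic to T × T. -/
/-!
STATEMENT 0: For a semilocal ring `R` (i.e. `R` modulo its Jacobson radical, the
intersection of all maximal left ideals, is semisimple) and a left `R`-module `M`,
the following are equivalent:
(1) the action of `Rˣ` on `M` has finitely many orbits;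
(2) `M` has only finitely many submodules;
(3) `M` has finite length and there do not exist submodules `N ≤ N'` of `M` and a
    simple left `R`-module `T` with infinite endomorphism ring such that `N'/N ≅ T × T`.
-/

universe u v

namespace Semilocal

section Cancellation

variable {S : Type*} [Ring S] [IsSemisimpleRing S]

theorem nonempty_linearEquiv_ker_prod {W X : Type*} [AddCommGroup W] [Module S W]
    [AddCommGroup X] [Module S X] (f : W →ₗ[S] X)
    (hf : Function.Surjective f) : Nonempty (W ≃ₗ[S] LinearMap.ker f × X) := by
  obtain ⟨C, hC⟩ := exists_isCompl (LinearMap.ker f)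
  exact ⟨(Submodule.prodEquivOfIsCompl _ C hC).symm ≪≫ₗ
    (LinearEquiv.refl S _).prodCongr ((Submodule.quotientEquivOfIsCompl _ C hC).symm ≪≫ₗ
      f.quotKerEquivOfSurjective hf)⟩

/-- Quotients of a semisimple module by isomorphic simple submodules are isomorphic. -/
theorem nonempty_quotient_linearEquiv_of_isSimpleModule {V : Type*} [AddCommGroup V] [Module S V]
    (A A' : Submodule S V) [IsSimpleModule S A] (e : A ≃ₗ[S] A') :
    Nonempty ((V ⧸ A) ≃ₗ[S] V ⧸ A') := by
  have : IsSimpleModule S A' := IsSimpleModule.congr e.symm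
  have hA' : IsAtom A' := isSimpleModule_iff_isAtom.mp ‹_›
  obtain ⟨B, hB⟩ := exists_isCompl A
  by_cases hle : A' ≤ B
  · obtain ⟨C, hC⟩ := exists_isCompl A'
    let s := A.projectionOnto B hB
    let r : V →ₗ[S] A' := A'.projectionOnto C hC ∘ₗ (LinearMap.id - A.subtype ∘ₗ s)
    have hsA (a : A) : s a = a := A.projectionOnto_apply_left hB a
    have hsA' (a : A') : s a = 0 := A.projectionOnto_apply_of_mem_right hB (hle a.2)
    have hrA (a : A) : r a = 0 := by simp [r, hsA]
    have hrA' (a : A') : r a = a := by simp [r, hsA']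
    let σ : V →ₗ[S] V := LinearMap.id - A.subtype ∘ₗ s - A'.subtype ∘ₗ r +
      A'.subtype ∘ₗ e.toLinearMap ∘ₗ s + A.subtype ∘ₗ e.symm.toLinearMap ∘ₗ r
    have hσσ (v : V) : σ (σ v) = v := by
      simp only [σ, LinearMap.add_apply, LinearMap.sub_apply, LinearMap.id_apply,
        LinearMap.comp_apply, Submodule.subtype_apply, LinearEquiv.coe_coe, map_add, map_sub,
        hsA, hsA', hrA, hrA', LinearEquiv.symm_apply_apply, LinearEquiv.apply_symm_apply,
        map_zero]
      abel
    have hσA (a : A) : σ a = e a := by simp [σ, hsA, hrA]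
    let τ : V ≃ₗ[S] V := .ofInvolutive σ hσσ
    refine ⟨Submodule.Quotient.equiv A A' τ (le_antisymm ?_ fun x hx ↦ ?_)⟩
    · rintro _ ⟨a, ha, rfl⟩
      exact (hσA ⟨a, ha⟩).symm ▸ (e ⟨a, ha⟩).2
    · exact ⟨e.symm ⟨x, hx⟩, (e.symm ⟨x, hx⟩).2, (hσA _).trans (by simp)⟩
  · have hB' : IsCoatom B := isSimpleModule_iff_isCoatom.mp
      (IsSimpleModule.congr (B.quotientEquivOfIsCompl A hB.symm))
    have hA'B : IsCompl A' B := by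
      refine ⟨hA'.not_le_iff_disjoint.mp hle, codisjoint_iff.mpr (hB'.2 _ ?_)⟩
      exact lt_of_le_of_ne le_sup_right fun h ↦ hle (h ▸ le_sup_left)
    exact ⟨A.quotientEquivOfIsCompl B hB ≪≫ₗ (A'.quotientEquivOfIsCompl B hA'B).symm⟩

theorem nonempty_linearEquiv_of_prod_isSimpleModule {P Q T : Type*} [AddCommGroup P] [Module S P]
    [AddCommGroup Q] [Module S Q] [AddCommGroup T] [Module S T] [IsSimpleModule S T]
    (φ : (P × T) ≃ₗ[S] Q × T) : Nonempty (P ≃ₗ[S] Q) := by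
  let A := LinearMap.range (LinearMap.inr S P T)
  let B := LinearMap.range (LinearMap.inr S Q T)
  let eA : T ≃ₗ[S] A := .ofInjective _ LinearMap.inr_injective
  let eB : T ≃ₗ[S] B := .ofInjective _ LinearMap.inr_injective
  let A' := A.map φ.toLinearMap
  have : IsSimpleModule S B := IsSimpleModule.congr eB.symm
  obtain ⟨ψ⟩ := nonempty_quotient_linearEquiv_of_isSimpleModule B A'
    (eB.symm ≪≫ₗ eA ≪≫ₗ φ.submoduleMap A)
  let qP : ((P × T) ⧸ A) ≃ₗ[S] P := Submodule.quotEquivOfEq _ _ (LinearMap.range_inr S _ T) ≪≫ₗ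
    (LinearMap.fst S P T).quotKerEquivOfSurjective LinearMap.fst_surjective
  let qQ : ((Q × T) ⧸ B) ≃ₗ[S] Q := Submodule.quotEquivOfEq _ _ (LinearMap.range_inr S _ T) ≪≫ₗ
    (LinearMap.fst S Q T).quotKerEquivOfSurjective LinearMap.fst_surjective
  exact ⟨qP.symm ≪≫ₗ Submodule.Quotient.equiv A A' φ rfl ≪≫ₗ ψ.symm ≪≫ₗ qQ⟩

/-- Modules of finite length over a semisimple ring may be cancelled from direct sums. -/
theorem nonempty_linearEquiv_of_prod_isFiniteLength {A : Type v} [AddCommGroup A] [Module S A]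
    (hA : IsFiniteLength S A) {P Q : Type v} [AddCommGroup P] [Module S P]
    [AddCommGroup Q] [Module S Q] (φ : (P × A) ≃ₗ[S] Q × A) : Nonempty (P ≃ₗ[S] Q) := by
  induction hA generalizing P Q with
  | @of_subsingleton A =>
    have : Unique A := uniqueOfSubsingleton 0
    exact ⟨LinearEquiv.prodUnique.symm ≪≫ₗ φ ≪≫ₗ LinearEquiv.prodUnique⟩
  | @of_simple_quotient A _ _ N _ _ ih =>
    obtain ⟨C, hC⟩ := exists_isCompl N
    let e : A ≃ₗ[S] (A ⧸ N) × N := (N.prodEquivOfIsCompl C hC).symm ≪≫ₗ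
      LinearEquiv.prodComm S _ _ ≪≫ₗ (N.quotientEquivOfIsCompl C hC).symm.prodCongr (.refl S _)
    obtain ⟨ψ⟩ := ih ((LinearEquiv.prodAssoc S P (A ⧸ N) N) ≪≫ₗ
      (LinearEquiv.refl S P).prodCongr e.symm ≪≫ₗ φ ≪≫ₗ (LinearEquiv.refl S Q).prodCongr e ≪≫ₗ
      (LinearEquiv.prodAssoc S Q (A ⧸ N) N).symm)
    exact nonempty_linearEquiv_of_prod_isSimpleModule ψ

/-- In a module of finite length over a semisimple ring, the kernel and the cokernel of an
endomorphism are isomorphic. -/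
theorem nonempty_ker_linearEquiv_quotient_range {V : Type*} [AddCommGroup V] [Module S V]
    [Module.Finite S V] (α : Module.End S V) :
    Nonempty (LinearMap.ker α ≃ₗ[S] V ⧸ LinearMap.range α) := by
  obtain ⟨e⟩ := nonempty_linearEquiv_ker_prod α.rangeRestrict α.surjective_rangeRestrict
  obtain ⟨e'⟩ := nonempty_linearEquiv_ker_prod (LinearMap.range α).mkQ
    (Submodule.mkQ_surjective _)
  rw [LinearMap.ker_rangeRestrict] at e
  rw [Submodule.ker_mkQ] at e'
  exact nonempty_linearEquiv_of_prod_isFiniteLength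
    (isFiniteLength_iff_isNoetherian_isArtinian.mpr ⟨inferInstance, inferInstance⟩)
    (e.symm ≪≫ₗ e' ≪≫ₗ LinearEquiv.prodComm S _ _)

end Cancellation

section StableRange

theorem exists_isUnit_end_add_mul {S V : Type*} [Ring S] [IsSemisimpleRing S] [AddCommGroup V]
    [Module S V] [Module.Finite S V] {α δ p q : Module.End S V} (h : α * p + δ * q = 1) :
    ∃ c, IsUnit (α + δ * c) := by
  obtain ⟨e⟩ := nonempty_ker_linearEquiv_quotient_range α
  obtain ⟨C, hC⟩ := exists_isCompl (LinearMap.ker α)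
  have hδ : Function.Surjective ((LinearMap.range α).mkQ ∘ₗ δ) := by
    intro x
    obtain ⟨v, rfl⟩ := Submodule.mkQ_surjective _ x
    refine ⟨q v, (Submodule.Quotient.eq _).mpr ⟨- p v, ?_⟩⟩
    have hv : α (p v) + δ (q v) = v := LinearMap.congr_fun h v
    rw [map_neg, neg_eq_iff_eq_neg, neg_sub]
    exact eq_sub_of_add_eq hv
  obtain ⟨g, hg⟩ := IsSemisimpleModule.lifting_property _ hδ e.toLinearMap
  let π := (LinearMap.ker α).projectionOnto C hC
  refine ⟨g ∘ₗ π, (Module.End.isUnit_iff _).mpr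
    (IsArtinian.bijective_of_injective_endomorphism _ <|
      (injective_iff_map_eq_zero _).mpr fun v hv ↦ ?_)⟩
  replace hv : α v + δ (g (π v)) = 0 := hv
  have hπ : π v = 0 := by
    have h₁ := congr_arg (LinearMap.range α).mkQ hv
    have h₂ : (LinearMap.range α).mkQ (α v) = 0 :=
      (Submodule.Quotient.mk_eq_zero _).mpr ⟨v, rfl⟩
    rw [map_add, h₂, zero_add, map_zero] at h₁
    exact e.injective (((LinearMap.congr_fun hg (π v)).symm.trans h₁).trans (map_zero e).symm)
  rw [hπ, map_zero, map_zero, add_zero] at hv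
  exact congr_arg Subtype.val
    ((Submodule.projectionOnto_apply_left hC ⟨v, hv⟩).symm.trans hπ)

theorem exists_isUnit_add_mul_of_isSemisimpleRing {S : Type*} [Ring S] [IsSemisimpleRing S]
    {a d p q : S} (h : p * a + q * d = 1) : ∃ c, IsUnit (a + c * d) := by
  let f := RingEquiv.moduleEndSelf S
  obtain ⟨c, hc⟩ := exists_isUnit_end_add_mul (α := f (.op a)) (δ := f (.op d)) (p := f (.op p))
    (q := f (.op q)) (by
      rw [← map_mul, ← map_mul, ← map_add, ← MulOpposite.op_mul, ← MulOpposite.op_mul,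
        ← MulOpposite.op_add, h, MulOpposite.op_one, map_one])
  obtain ⟨c, rfl⟩ := f.surjective c
  rw [← map_mul, ← map_add, MulEquiv.isUnit_map] at hc
  exact ⟨c.unop, hc.unop⟩

variable {R : Type*} [Ring R]

theorem exists_mul_eq_one_of_sub_one_mem_jacobson {r : R}
    (h : r - 1 ∈ Ideal.jacobson (⊥ : Ideal R)) : ∃ s, s * r = 1 := by
  obtain ⟨s, hs⟩ := Ideal.exists_mul_sub_mem_of_sub_one_mem_jacobson r h
  exact ⟨s, sub_eq_zero.mp hs⟩

theorem isUnit_of_sub_one_mem_jacobson {r : R}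
    (h : r - 1 ∈ Ideal.jacobson (⊥ : Ideal R)) : IsUnit r := by
  obtain ⟨s, hs⟩ := exists_mul_eq_one_of_sub_one_mem_jacobson h
  obtain ⟨t, ht⟩ := exists_mul_eq_one_of_sub_one_mem_jacobson (r := s) (by
    have := Ideal.mul_mem_left _ (-s) h
    rwa [mul_sub, neg_mul, hs, mul_one, sub_neg_eq_add, neg_add_eq_sub] at this)
  exact ⟨⟨r, s, by rwa [← left_inv_eq_right_inv ht hs], hs⟩, rfl⟩

theorem isUnit_of_isUnit_mk_jacobson {r : R}
    (h : IsUnit (Ideal.Quotient.mk (Ideal.jacobson (⊥ : Ideal R)) r)) : IsUnit r := by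
  obtain ⟨s', h₁, h₂⟩ := isUnit_iff_exists.mp h
  obtain ⟨s, rfl⟩ := Ideal.Quotient.mk_surjective s'
  rw [← map_mul, ← map_one (Ideal.Quotient.mk _), Ideal.Quotient.eq] at h₁ h₂
  obtain ⟨s₁, hs₁⟩ := (isUnit_of_sub_one_mem_jacobson h₁).exists_right_inv
  obtain ⟨s₂, hs₂⟩ := (isUnit_of_sub_one_mem_jacobson h₂).exists_left_inv
  exact isUnit_iff_exists_and_exists.mpr
    ⟨⟨s * s₁, by rw [← mul_assoc, hs₁]⟩, ⟨s₂ * s, by rw [mul_assoc, hs₂]⟩⟩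

/-- Semilocal rings have stable range one (Bass). -/
theorem exists_isUnit_add_mul
    (hR : IsSemisimpleModule R (R ⧸ Ideal.jacobson (⊥ : Ideal R)))
    {a d p q : R} (h : p * a + q * d = 1) : ∃ c, IsUnit (a + c * d) := by
  let J := Ideal.jacobson (⊥ : Ideal R)
  have : IsSemisimpleRing (R ⧸ J) := by
    let l : (R ⧸ J) →ₛₗ[Ideal.Quotient.mk J] R ⧸ J :=
      { toFun := id
        map_add' := fun _ _ ↦ rfl
        map_smul' := fun r x ↦ by
          obtain ⟨x, rfl⟩ := Ideal.Quotient.mk_surjective x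
          rfl }
    have : RingHomSurjective (Ideal.Quotient.mk J) := ⟨Ideal.Quotient.mk_surjective⟩
    exact (LinearMap.isSemisimpleModule_iff_of_bijective l Function.bijective_id).mp hR
  obtain ⟨c', hc⟩ := exists_isUnit_add_mul_of_isSemisimpleRing
    (a := Ideal.Quotient.mk J a) (d := Ideal.Quotient.mk J d) (p := Ideal.Quotient.mk J p)
    (q := Ideal.Quotient.mk J q) (by rw [← map_mul, ← map_mul, ← map_add, h, map_one])
  obtain ⟨c, rfl⟩ := Ideal.Quotient.mk_surjective c'
  exact ⟨c, isUnit_of_isUnit_mk_jacobson (by simpa using hc)⟩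

/-- Over a semilocal ring, two generators of the same cyclic module differ by a unit. -/
theorem exists_units_smul_eq_of_span_singleton_eq
    (hR : IsSemisimpleModule R (R ⧸ Ideal.jacobson (⊥ : Ideal R)))
    {M : Type*} [AddCommGroup M] [Module R M] {x y : M}
    (h : Submodule.span R {x} = Submodule.span R {y}) : ∃ u : Rˣ, u • y = x := by
  obtain ⟨a, ha⟩ := Submodule.mem_span_singleton.mp (h ▸ Submodule.mem_span_singleton_self x)
  obtain ⟨b, hb⟩ := Submodule.mem_span_singleton.mp (h.symm ▸ Submodule.mem_span_singleton_self y)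
  obtain ⟨c, u, hu⟩ := exists_isUnit_add_mul hR (a := a) (d := 1 - b * a) (p := b) (q := 1)
    (by rw [one_mul, add_sub_cancel])
  refine ⟨u, ?_⟩
  rw [Units.smul_def, hu, add_smul, mul_smul, sub_smul, mul_smul, ha, hb, one_smul, sub_self,
    smul_zero, add_zero]

end StableRange

section FiniteSubmodules

variable {R : Type u} [Ring R]

/-- If a coatom has infinitely many complements that are coatoms, then the module is the square
of a simple module with infinite endomorphism ring. -/
theorem exists_linearEquiv_prod_of_infinite_isCompl {V : Type v} [AddCommGroup V] [Module R V]
    {A : Submodule R V} (hA : IsCoatom A)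
    (hinf : {B : Submodule R V | IsCoatom B ∧ IsCompl A B}.Infinite) :
    IsSimpleModule R A ∧ Infinite (Module.End R A) ∧ Nonempty (V ≃ₗ[R] A × A) := by
  obtain ⟨B, hB, hAB⟩ := hinf.nonempty
  have hsA : IsSimpleModule R A :=
    have := isSimpleModule_iff_isCoatom.mpr hB
    IsSimpleModule.congr (B.quotientEquivOfIsCompl A hAB.symm).symm
  have hsB : IsSimpleModule R B :=
    have := isSimpleModule_iff_isCoatom.mpr hA
    IsSimpleModule.congr (A.quotientEquivOfIsCompl B hAB).symm
  have : Infinite {C : Submodule R V // IsCompl A C} :=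
    (hinf.mono fun _ h ↦ h.2).to_subtype
  have : Infinite (B →ₗ[R] A) := by
    refine Infinite.of_injective
      (fun C : {C : Submodule R V // IsCompl A C} ↦ (A.isComplEquivProj C).1 ∘ₗ B.subtype)
      fun C C' h ↦ A.isComplEquivProj.injective (Subtype.ext (LinearMap.ext fun v ↦ ?_))
    obtain ⟨⟨a, b⟩, rfl⟩ := (A.prodEquivOfIsCompl B hAB).surjective v
    have h' := LinearMap.congr_fun h b
    simp only [LinearMap.comp_apply, Submodule.subtype_apply] at h'
    rw [Submodule.coe_prodEquivOfIsCompl', map_add, map_add, (A.isComplEquivProj C).2,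
      (A.isComplEquivProj C').2, h']
  obtain ⟨f, hf⟩ := exists_ne (0 : B →ₗ[R] A)
  let e : B ≃ₗ[R] A := .ofBijective f (LinearMap.bijective_of_ne_zero hf)
  refine ⟨hsA, Infinite.of_injective (fun g : B →ₗ[R] A ↦ g ∘ₗ e.symm.toLinearMap) ?_,
    ⟨(A.prodEquivOfIsCompl B hAB).symm ≪≫ₗ (LinearEquiv.refl R A).prodCongr e⟩⟩
  intro g g' h
  ext b
  simpa using congr_arg Subtype.val (LinearMap.congr_fun h (e b))

theorem exists_quotient_linearEquiv_prod_of_infinite_isCoatom {V : Type v} [AddCommGroup V]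
    [Module R V] (hfin : ∀ A : Submodule R V, IsCoatom A → Finite (Submodule R A))
    (hinf : {A : Submodule R V | IsCoatom A}.Infinite) :
    ∃ (T : Type v) (_ : AddCommGroup T) (_ : Module R T) (N : Submodule R V),
      IsSimpleModule R T ∧ Infinite (Module.End R T) ∧ Nonempty ((V ⧸ N) ≃ₗ[R] (T × T)) := by
  obtain ⟨A, hA : IsCoatom A⟩ := hinf.nonempty
  have := hfin A hA
  have hIic : (Set.Iic A).Finite :=
    Set.finite_coe_iff.mp (Finite.of_equiv _ (Submodule.mapIic A).toEquiv)
  obtain ⟨N, hN, hfib⟩ : ∃ N ≤ A, {B | IsCoatom B ∧ B ≠ A ∧ A ⊓ B = N}.Infinite := by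
    by_contra! hcon
    refine (hinf.sdiff (Set.finite_singleton A))
      ((hIic.biUnion fun N hN ↦ hcon N hN).subset fun B hB ↦ ?_)
    exact Set.mem_biUnion (x := A ⊓ B) (Set.mem_Iic.mpr inf_le_left) ⟨hB.1, hB.2, rfl⟩
  let o : Set.Ici N ≃o Submodule R (V ⧸ N) := N.comapMkQRelIso.symm
  have hpre : ((↑) ⁻¹' {B | IsCoatom B ∧ B ≠ A ∧ A ⊓ B = N} : Set (Set.Ici N)).Infinite :=
    hfib.preimage fun B hB ↦ ⟨⟨B, Set.mem_Ici.mpr (hB.2.2 ▸ inf_le_right)⟩, rfl⟩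
  obtain ⟨h₁, h₂, h₃⟩ := exists_linearEquiv_prod_of_infinite_isCompl
    ((o.isCoatom_iff _).mpr (hA.Ici hN)) <| (hpre.image o.injective.injOn).mono <| by
      rintro _ ⟨⟨B, hNB⟩, ⟨hB, hne, hAB⟩, rfl⟩
      refine ⟨(o.isCoatom_iff _).mpr (hB.Ici hNB), o.isCompl_iff.mp ⟨?_, ?_⟩⟩
      · exact disjoint_iff.mpr (Subtype.ext hAB)
      · exact codisjoint_iff.mpr (Subtype.ext (hA.sup_eq_top_of_ne hB hne.symm))
  exact ⟨_, _, _, N, h₁, h₂, h₃⟩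

theorem finite_submodule_of_isFiniteLength {M : Type v} [AddCommGroup M] [Module R M]
    (hM : IsFiniteLength R M)
    (h : ¬ ∃ (T : Type v) (_ : AddCommGroup T) (_ : Module R T)
      (N N' : Submodule R M) (_ : N ≤ N'), IsSimpleModule R T ∧ Infinite (Module.End R T) ∧
        Nonempty ((↥N' ⧸ Submodule.comap N'.subtype N) ≃ₗ[R] (T × T))) :
    Finite (Submodule R M) := by
  obtain ⟨_, _⟩ := isFiniteLength_iff_isNoetherian_isArtinian.mp hM
  suffices ∀ P : Submodule R M, Finite (Submodule R P) from
    have := this ⊤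
    Finite.of_equiv _ (Submodule.orderIsoMapComap (Submodule.topEquiv (R := R) (M := M))).toEquiv
  intro P
  induction P using WellFoundedLT.induction with
  | ind P ih =>
  have ih' (A : Submodule R P) (hA : IsCoatom A) : Finite (Submodule R A) := by
    have hlt : A.map P.subtype < P := by
      simpa using Submodule.map_strictMono_of_injective P.injective_subtype hA.lt_top
    have := ih _ hlt
    exact Finite.of_equiv _ (Submodule.orderIsoMapComap (P.equivSubtypeMap A)).symm.toEquiv
  have hco : {A : Submodule R P | IsCoatom A}.Finite := by
    by_contra hinf
    obtain ⟨T, i₁, i₂, N, h₁, h₂, h₃⟩ :=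
      exists_quotient_linearEquiv_prod_of_infinite_isCoatom ih' hinf
    refine h ⟨T, i₁, i₂, N.map P.subtype, P, P.map_subtype_le N, h₁, h₂, ?_⟩
    rwa [Submodule.comap_map_eq_of_injective P.injective_subtype]
  refine Set.finite_univ_iff.mp (((hco.biUnion (t := Set.Iic) fun A hA ↦ ?_).union
    (Set.finite_singleton ⊤)).subset fun Q _ ↦ ?_)
  · have := ih' A hA
    exact Set.finite_coe_iff.mp (Finite.of_equiv _ (Submodule.mapIic A).toEquiv)
  · rcases eq_top_or_exists_le_coatom Q with rfl | ⟨A, hA, hQA⟩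
    · exact Or.inr rfl
    · exact Or.inl (Set.mem_biUnion hA hQA)

theorem finite_end_of_finite_submodule_prod {T : Type*} [AddCommGroup T] [Module R T]
    [Finite (Submodule R (T × T))] : Finite (Module.End R T) := by
  refine Finite.of_injective (fun f : Module.End R T ↦ LinearMap.graph f) fun f g h ↦ ?_
  ext x
  have : (x, f x) ∈ LinearMap.graph g := by
    rw [← show LinearMap.graph f = LinearMap.graph g from h]
    simp
  simpa using this

end FiniteSubmodules

section Orbits

variable {R : Type*} [Ring R] {M : Type*} [AddCommGroup M] [Module R M]

theorem finite_submodule_of_finite_orbits [Finite (MulAction.orbitRel.Quotient Rˣ M)] :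
    Finite (Submodule R M) := by
  let mk : M → MulAction.orbitRel.Quotient Rˣ M := Quotient.mk _
  have hle {N N' : Submodule R M} (h : mk '' N = mk '' N') : N ≤ N' := fun x hx ↦ by
    obtain ⟨y, hy, hxy⟩ := h ▸ Set.mem_image_of_mem mk hx
    obtain ⟨u, rfl⟩ := Quotient.exact hxy.symm
    exact N'.smul_mem (u : R) hy
  exact Finite.of_injective (fun N : Submodule R M ↦ mk '' N)
    fun N N' h ↦ le_antisymm (hle h) (hle h.symm)

theorem finite_orbits_of_finite_submodule
    (hR : IsSemisimpleModule R (R ⧸ Ideal.jacobson (⊥ : Ideal R))) [Finite (Submodule R M)] :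
    Finite (MulAction.orbitRel.Quotient Rˣ M) := by
  let f : MulAction.orbitRel.Quotient Rˣ M → Submodule R M :=
    Quotient.lift (fun x ↦ Submodule.span R {x}) <| by
      rintro _ y ⟨u, rfl⟩
      exact Submodule.span_singleton_group_smul_eq R u y
  refine Finite.of_injective f fun a b ↦ Quotient.inductionOn₂ a b fun x y h ↦ ?_
  exact Quotient.sound (exists_units_smul_eq_of_span_singleton_eq hR h)

end Orbits

end Semilocal

theorem finite_orbits_tfae_of_semilocal
    (R : Type u) [Ring R]
    (hsemilocal : IsSemisimpleModule R (R ⧸ Ideal.jacobson (⊥ : Ideal R)))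
    (M : Type v) [AddCommGroup M] [Module R M] :
    List.TFAE
      [Finite (MulAction.orbitRel.Quotient Rˣ M),
       Finite (Submodule R M),
       IsFiniteLength R M ∧
         ¬ ∃ (T : Type v) (_ : AddCommGroup T) (_ : Module R T)
             (N N' : Submodule R M) (_ : N ≤ N'),
             IsSimpleModule R T ∧ Infinite (Module.End R T) ∧
               Nonempty ((↥N' ⧸ Submodule.comap N'.subtype N) ≃ₗ[R] (T × T))] := by
  tfae_have 1 → 2 := fun _ ↦ Semilocal.finite_submodule_of_finite_orbits
  tfae_have 2 → 1 := fun _ ↦ Semilocal.finite_orbits_of_finite_submodule hsemilocal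
  tfae_have 3 → 2 := fun h ↦ Semilocal.finite_submodule_of_isFiniteLength h.1 h.2
  tfae_have 2 → 3 := by
    intro hfin
    refine ⟨isFiniteLength_iff_isNoetherian_isArtinian.mpr
      ⟨isNoetherian_iff'.mpr inferInstance, inferInstance⟩, ?_⟩
    rintro ⟨T, _, _, N, N', _, _, hT, ⟨e⟩⟩
    have : Finite (Submodule R N') :=
      Finite.of_injective _ (Submodule.map_injective_of_injective N'.injective_subtype)
    have : Finite (Submodule R (N' ⧸ N.comap N'.subtype)) :=
      Finite.of_injective _ (Submodule.comap_injective_of_surjective (Submodule.mkQ_surjective _))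
    have : Finite (Submodule R (T × T)) :=
      Finite.of_equiv _ (Submodule.orderIsoMapComap e).toEquiv
    exact not_finite_iff_infinite.mpr hT Semilocal.finite_end_of_finite_submodule_prod
  tfae_finish
end

section
/- Let R be any ring and M a left R-module. Then M has only finitely many submodules if and only if M has finite length and there do not exist submodules N ≤ N' of M and a simple left R-module T with infinite endomorphism ring such that N'/N is isomorphic to T × T. -/
/-!
STATEMENT 1: For any ring `R` and left `R`-module `M`: `M` has only finitely many
submodules if and only if `M` has finite length and there do not exist submodules
`N ≤ N'` of `M` and a simple left `R`-module `T` with infinite endomorphism ring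
such that `N'/N ≅ T × T`.
-/

universe u v

section Lattice

variable {L : Type*} [Lattice L]

theorem CovBy.inf_eq_of_ne {n a b : L} (ha : n ⋖ a) (hb : n ⋖ b) (hab : a ≠ b) :
    a ⊓ b = n := by
  rcases ha.eq_or_eq (le_inf ha.le hb.le) inf_le_left with h | h
  · exact h
  · rcases hb.eq_or_eq ha.le (inf_eq_left.mp h) with h' | h'
    · exact absurd h' ha.lt.ne'
    · exact absurd h' hab

theorem CovBy.covBy_sup_of_ne [IsModularLattice L] {n a b : L} (ha : n ⋖ a) (hb : n ⋖ b)
    (hab : a ≠ b) : a ⋖ a ⊔ b :=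
  covBy_sup_of_inf_covBy_right (by rwa [ha.inf_eq_of_ne hb hab])

/-- In a modular lattice, two upper covers `a, b` of `n` with `a` not below a coatom `c` of `[n, p]`
span an element that meets `c` in an upper cover `d` of `n`, and `a ⊔ d = a ⊔ b`. -/
theorem covBy_sup_inf_of_covBy [IsModularLattice L] {n a b c p : L} (ha : n ⋖ a) (hb : n ⋖ b)
    (hab : a ≠ b) (hcp : c ⋖ p) (hnc : n ≤ c) (hap : a ≤ p) (hbp : b ≤ p) (hac : ¬ a ≤ c) :
    n ⋖ (a ⊔ b) ⊓ c ∧ a ⊔ (a ⊔ b) ⊓ c = a ⊔ b := by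
  have h1 : a ⋖ a ⊔ b := ha.covBy_sup_of_ne hb hab
  have h2 : (a ⊔ b) ⊔ c = p := by
    rcases hcp.eq_or_eq (le_sup_right : c ≤ (a ⊔ b) ⊔ c) (sup_le (sup_le hap hbp) hcp.le) with h | h
    · exact absurd (le_sup_left.trans (le_sup_left.trans h.le)) hac
    · exact h
  have h3 : (a ⊔ b) ⊓ c ⋖ a ⊔ b := inf_covBy_of_covBy_sup_right (by rwa [h2])
  have h4 : a ⊓ ((a ⊔ b) ⊓ c) = n := by
    rcases ha.eq_or_eq (le_inf ha.le (le_inf (ha.le.trans le_sup_left) hnc)) inf_le_left with h | h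
    · exact h
    · exact absurd ((inf_eq_left.mp h).trans inf_le_right) hac
  have h5 : a ⊔ (a ⊔ b) ⊓ c = a ⊔ b := by
    rcases h1.eq_or_eq (le_sup_left : a ≤ a ⊔ (a ⊔ b) ⊓ c) (sup_le le_sup_left inf_le_left)
      with h | h
    · have hle : (a ⊔ b) ⊓ c ≤ a := sup_eq_left.mp h
      rcases h3.eq_or_eq hle le_sup_left with h' | h'
      · exact absurd (h'.le.trans inf_le_right) hac
      · exact absurd h' h1.lt.ne
    · exact h
  refine ⟨?_, h5⟩
  have h6 : a ⊓ ((a ⊔ b) ⊓ c) ⋖ (a ⊔ b) ⊓ c := inf_covBy_of_covBy_sup_left (by rwa [h5])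
  rwa [h4] at h6

/-- An infinite modular lattice satisfying both chain conditions has an interval `[n, p]` of
length two with infinitely many atoms. -/
theorem exists_infinite_covBy_of_infinite [IsModularLattice L] [OrderBot L] [OrderTop L]
    [WellFoundedLT L] [WellFoundedGT L] [Infinite L] :
    ∃ n p : L, {a | n ⋖ a ∧ a ≤ p}.Infinite ∧
      ∀ a b, n ⋖ a → a ≤ p → n ⋖ b → b ≤ p → a ≠ b → a ⊔ b = p := by
  obtain ⟨n, hn, hmax⟩ := (wellFounded_gt (α := L)).has_min {n | (Set.Ici n).Infinite}
    ⟨⊥, by simpa using Set.infinite_univ⟩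
  have hfin : ∀ x, n < x → (Set.Ici x).Finite := fun x hx ↦
    Set.not_infinite.mp fun h ↦ hmax x h hx
  have hcov : {a | n ⋖ a}.Infinite := fun h ↦ by
    refine hn (((Set.finite_singleton n).union
      (h.biUnion fun a (ha : n ⋖ a) ↦ hfin a ha.lt)).subset fun x (hx : n ≤ x) ↦ ?_)
    rcases hx.eq_or_lt with rfl | hlt
    · exact Or.inl rfl
    · obtain ⟨a, ha, hax⟩ := exists_covBy_le_of_lt hlt
      exact Or.inr (Set.mem_biUnion (show a ∈ {a | n ⋖ a} from ha) hax)
  obtain ⟨p, hp, hmin⟩ := (wellFounded_lt (α := L)).has_min {p | {a | n ⋖ a ∧ a ≤ p}.Infinite}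
    ⟨⊤, by simpa using hcov⟩
  obtain ⟨a₀, ha₀, ha₀p⟩ := hp.nonempty
  obtain ⟨c, hnc, hcp⟩ := exists_le_covBy_of_lt (ha₀.lt.trans_le ha₀p)
  have hc : {a | n ⋖ a ∧ a ≤ c}.Finite := Set.not_infinite.mp fun h ↦ hmin c h hcp.lt
  obtain ⟨a, ⟨ha, hap⟩, hac'⟩ := (hp.sdiff hc).nonempty
  have hac : ¬ a ≤ c := fun h ↦ hac' ⟨ha, h⟩
  have hS : ({b | n ⋖ b ∧ b ≤ p} \ {a}).Infinite := hp.sdiff (Set.finite_singleton a)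
  have key : ∀ b ∈ {b | n ⋖ b ∧ b ≤ p} \ {a}, n ⋖ (a ⊔ b) ⊓ c ∧ a ⊔ (a ⊔ b) ⊓ c = a ⊔ b :=
    fun b hb ↦ covBy_sup_inf_of_covBy ha hb.1.1 (Ne.symm hb.2) hcp hnc hap hb.1.2 hac
  obtain ⟨d, hd⟩ : ∃ d, {b ∈ {b | n ⋖ b ∧ b ≤ p} \ {a} | (a ⊔ b) ⊓ c = d}.Infinite := by
    by_contra! h
    refine hS ((hc.biUnion fun d _ ↦ h d).subset fun b hb ↦ ?_)
    exact Set.mem_biUnion (show (a ⊔ b) ⊓ c ∈ {a | n ⋖ a ∧ a ≤ c} from ⟨(key b hb).1, inf_le_right⟩)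
      ⟨hb, rfl⟩
  have hsup : ∀ b ∈ {b ∈ {b | n ⋖ b ∧ b ≤ p} \ {a} | (a ⊔ b) ⊓ c = d}, a ⊔ b = a ⊔ d :=
    fun b hb ↦ by rw [← hb.2, (key b hb.1).2]
  have haq : a ⋖ a ⊔ d := by
    obtain ⟨b, hb⟩ := hd.nonempty
    rw [← hsup b hb]
    exact ha.covBy_sup_of_ne hb.1.1.1 (Ne.symm hb.1.2)
  have hcovq : ∀ b, n ⋖ b → b ≤ a ⊔ d → b ⋖ a ⊔ d := fun b hb hbq ↦ by
    rcases eq_or_ne b a with rfl | hba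
    · exact haq
    · have h := ha.covBy_sup_of_ne hb hba.symm
      have h' : a ⊔ b = a ⊔ d :=
        (haq.eq_or_eq le_sup_left (sup_le le_sup_left hbq)).resolve_left h.lt.ne'
      rw [← h', sup_comm]
      exact hb.covBy_sup_of_ne ha hba
  refine ⟨n, a ⊔ d, hd.mono fun b hb ↦ ⟨hb.1.1.1, ?_⟩, fun b b' hb hbq hb' hbq' hne ↦ ?_⟩
  · rw [← hsup b hb]; exact le_sup_right
  · exact ((hcovq b hb hbq).eq_or_eq le_sup_left (sup_le hbq hbq')).resolve_left
      (hb.covBy_sup_of_ne hb' hne).lt.ne'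

end Lattice

section Module

variable {R : Type u} [Ring R]

theorem infinite_submodule_prod_self (T : Type*) [AddCommGroup T] [Module R T]
    [Infinite (Module.End R T)] : Infinite (Submodule R (T × T)) :=
  Infinite.of_injective (fun f : Module.End R T ↦ f.graph) fun f g h ↦ by
    ext x
    have hx : (x, f x) ∈ g.graph := by
      rw [← show f.graph = g.graph from h]
      exact (LinearMap.mem_graph_iff f _).mpr rfl
    exact (LinearMap.mem_graph_iff g _).mp hx

/-- A module with infinitely many pairwise complementary submodules is the square of one
of them, which has an infinite endomorphism ring. -/
theorem infinite_end_and_nonempty_equiv_prod_of_infinite_isCompl {Q : Type v} [AddCommGroup Q]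
    [Module R Q] {S : Set (Submodule R Q)} (hS : S.Infinite) (hcompl : S.Pairwise IsCompl) :
    ∃ A ∈ S, Infinite (Module.End R A) ∧ Nonempty (Q ≃ₗ[R] A × A) := by
  obtain ⟨A, hA⟩ := hS.nonempty
  obtain ⟨B, hB, hBA⟩ := (hS.sdiff (Set.finite_singleton A)).nonempty
  obtain ⟨C, hC, hCAB⟩ := (hS.sdiff (Set.toFinite {A, B})).nonempty
  simp only [Set.mem_singleton_iff, Set.mem_insert_iff, not_or] at hBA hCAB
  let eBA : B ≃ₗ[R] A :=
    (Submodule.quotientEquivOfIsCompl C B (hcompl hC hB hCAB.2)).symm.trans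
      (Submodule.quotientEquivOfIsCompl C A (hcompl hC hA hCAB.1))
  let e : Q ≃ₗ[R] A × A :=
    (Submodule.prodEquivOfIsCompl A B (hcompl hA hB (Ne.symm hBA))).symm.trans
      ((LinearEquiv.refl R A).prodCongr eBA)
  refine ⟨A, hA, ?_, ⟨e⟩⟩
  by_contra hfin
  rw [not_infinite_iff_finite] at hfin
  have hQ : Finite (Q →ₗ[R] A) :=
    Finite.of_injective
      (β := Module.End R A × Module.End R A)
      (fun f : Q →ₗ[R] A ↦ ((f ∘ₗ e.symm.toLinearMap) ∘ₗ LinearMap.inl R A A,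
        (f ∘ₗ e.symm.toLinearMap) ∘ₗ LinearMap.inr R A A)) fun f g h ↦ by
      have h' : f ∘ₗ e.symm.toLinearMap = g ∘ₗ e.symm.toLinearMap :=
        LinearMap.prod_ext (Prod.ext_iff.mp h).1 (Prod.ext_iff.mp h).2
      ext1 x
      simpa using LinearMap.congr_fun h' (e x)
  have hA_fin : {q | IsCompl A q}.Finite :=
    Set.finite_coe_iff.mp (Finite.of_equiv _ (Submodule.isComplEquivProj A).symm)
  refine (hS.sdiff (Set.finite_singleton A)) (hA_fin.subset ?_)
  exact fun q hq ↦ hcompl hA hq.1 (Ne.symm hq.2)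

variable {M : Type v} [AddCommGroup M] [Module R M] {N N' A B : Submodule R M}

theorem mk_mem_map_comap_subtype_iff (hNA : N ≤ A) (x : N') :
    (Submodule.comap N'.subtype N).mkQ x ∈
      (A.comap N'.subtype).map (Submodule.comap N'.subtype N).mkQ ↔ (x : M) ∈ A := by
  rw [← Submodule.mem_comap, Submodule.comap_map_mkQ, sup_eq_right.mpr (Submodule.comap_mono hNA),
    Submodule.mem_comap, Submodule.subtype_apply]

theorem isCompl_map_comap_subtype (hNA : N ≤ A) (hNB : N ≤ B) (hA : A ≤ N') (hB : B ≤ N')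
    (hinf : A ⊓ B = N) (hsup : A ⊔ B = N') :
    IsCompl ((A.comap N'.subtype).map (Submodule.comap N'.subtype N).mkQ)
      ((B.comap N'.subtype).map (Submodule.comap N'.subtype N).mkQ) := by
  constructor
  · rw [Submodule.disjoint_def]
    intro q hqA hqB
    obtain ⟨x, rfl⟩ := Submodule.mkQ_surjective _ q
    rw [mk_mem_map_comap_subtype_iff hNA] at hqA
    rw [mk_mem_map_comap_subtype_iff hNB] at hqB
    rw [Submodule.mkQ_apply, Submodule.Quotient.mk_eq_zero, Submodule.mem_comap, ← hinf]
    exact ⟨hqA, hqB⟩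
  · rw [codisjoint_iff, eq_top_iff]
    intro q _
    obtain ⟨x, rfl⟩ := Submodule.mkQ_surjective _ q
    obtain ⟨a, ha, b, hb, hab⟩ := Submodule.mem_sup.mp (hsup.ge x.2)
    have hx : x = ⟨a, hA ha⟩ + ⟨b, hB hb⟩ := Subtype.ext hab.symm
    rw [hx, map_add]
    exact Submodule.add_mem_sup ((mk_mem_map_comap_subtype_iff hNA _).mpr ha)
      ((mk_mem_map_comap_subtype_iff hNB _).mpr hb)

theorem isAtom_map_comap_subtype (hNA : N ⋖ A) (hA : A ≤ N') :
    IsAtom ((A.comap N'.subtype).map (Submodule.comap N'.subtype N).mkQ) := by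
  constructor
  · intro h
    refine hNA.lt.not_ge fun a ha ↦ ?_
    have := (mk_mem_map_comap_subtype_iff (N' := N') hNA.le ⟨a, hA ha⟩).mpr ha
    rw [h, Submodule.mem_bot, Submodule.mkQ_apply, Submodule.Quotient.mk_eq_zero] at this
    exact this
  · intro X hX
    have hNX : N ≤ (X.comap (Submodule.comap N'.subtype N).mkQ).map N'.subtype := fun x hx ↦
      ⟨⟨x, hA (hNA.le hx)⟩, by
        have h0 : (Submodule.comap N'.subtype N).mkQ ⟨x, hA (hNA.le hx)⟩ = 0 := by
          rw [Submodule.mkQ_apply, Submodule.Quotient.mk_eq_zero]; exact hx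
        rw [SetLike.mem_coe, Submodule.mem_comap, h0]
        exact X.zero_mem, rfl⟩
    have hXA : (X.comap (Submodule.comap N'.subtype N).mkQ).map N'.subtype ≤ A := by
      rintro _ ⟨x, hx, rfl⟩
      exact (mk_mem_map_comap_subtype_iff hNA.le x).mp (hX.le hx)
    rcases hNA.eq_or_eq hNX hXA with h | h
    · rw [eq_bot_iff]
      intro q hq
      obtain ⟨x, rfl⟩ := Submodule.mkQ_surjective _ q
      rw [Submodule.mem_bot, Submodule.mkQ_apply, Submodule.Quotient.mk_eq_zero]
      exact h.le ⟨x, hq, rfl⟩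
    · refine absurd ?_ hX.not_ge
      rintro _ ⟨x, hx, rfl⟩
      obtain ⟨y, hy, hyx⟩ := h.ge hx
      rwa [← show y = x from Subtype.ext hyx]

end Module

theorem finite_submodules_iff_finiteLength_and_no_infinite_square
    (R : Type u) [Ring R] (M : Type v) [AddCommGroup M] [Module R M] :
    Finite (Submodule R M) ↔
      (IsFiniteLength R M ∧
        ¬ ∃ (T : Type v) (_ : AddCommGroup T) (_ : Module R T)
            (N N' : Submodule R M) (_ : N ≤ N'),
            IsSimpleModule R T ∧ Infinite (Module.End R T) ∧
              Nonempty ((↥N' ⧸ Submodule.comap N'.subtype N) ≃ₗ[R] (T × T))) := by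
  constructor
  · intro hfin
    refine ⟨isFiniteLength_iff_isNoetherian_isArtinian.mpr
      ⟨isNoetherian_iff'.mpr inferInstance, (inferInstance : WellFoundedLT (Submodule R M))⟩, ?_⟩
    rintro ⟨T, _, _, N, N', -, -, hT, ⟨e⟩⟩
    have : Finite (Submodule R N') :=
      Finite.of_injective _ (Submodule.map_injective_of_injective N'.injective_subtype)
    have : Finite (Submodule R (N' ⧸ Submodule.comap N'.subtype N)) :=
      Finite.of_injective _ (Submodule.comap_injective_of_surjective (Submodule.mkQ_surjective _))
    have : Finite (Submodule R (T × T)) :=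
      Finite.of_equiv _ (Submodule.orderIsoMapComap e).toEquiv
    have := infinite_submodule_prod_self (R := R) T
    exact not_finite (Submodule R (T × T))
  · rintro ⟨hlen, hno⟩
    by_contra hinf
    rw [not_finite_iff_infinite] at hinf
    obtain ⟨_, _⟩ := isFiniteLength_iff_isNoetherian_isArtinian.mp hlen
    obtain ⟨N, N', hS, hsup⟩ := exists_infinite_covBy_of_infinite (L := Submodule R M)
    let φ (A : Submodule R M) : Submodule R (N' ⧸ Submodule.comap N'.subtype N) :=
      (A.comap N'.subtype).map (Submodule.comap N'.subtype N).mkQ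
    have hcompl : ∀ A ∈ {A | N ⋖ A ∧ A ≤ N'}, ∀ B ∈ {A | N ⋖ A ∧ A ≤ N'}, A ≠ B →
        IsCompl (φ A) (φ B) := fun A hA B hB hAB ↦
      isCompl_map_comap_subtype hA.1.le hB.1.le hA.2 hB.2 (hA.1.inf_eq_of_ne hB.1 hAB)
        (hsup A B hA.1 hA.2 hB.1 hB.2 hAB)
    have hinj : Set.InjOn φ {A | N ⋖ A ∧ A ≤ N'} := fun A hA B hB h ↦ by
      by_contra hAB
      have hd := (hcompl A hA B hB hAB).disjoint
      rw [← h, disjoint_self] at hd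
      exact (isAtom_map_comap_subtype hA.1 hA.2).1 hd
    obtain ⟨_, ⟨A, hA, rfl⟩, hEnd, he⟩ := infinite_end_and_nonempty_equiv_prod_of_infinite_isCompl
      (hS.image hinj) (by
        rintro _ ⟨A, hA, rfl⟩ _ ⟨B, hB, rfl⟩ hAB
        exact hcompl A hA B hB fun h ↦ hAB (h ▸ rfl))
    exact hno ⟨φ A, inferInstance, inferInstance, N, N', hA.1.le.trans hA.2,
      isSimpleModule_iff_isAtom.mpr (isAtom_map_comap_subtype hA.1 hA.2), hEnd, he⟩
end

section
/- Let R be a semilocal ring, M a left R-module, and x, y ∈ M such that the cyclic submodules R∙x and R∙y coincide. Then there exists a unit u ∈ Rˣ with x = u • y. -/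
/-!
STATEMENT 2: Over a semilocal ring `R` (i.e. `R` modulo its Jacobson radical, the
intersection of all maximal left ideals, is semisimple), if two elements of a module
generate the same cyclic submodule then they lie in the same orbit of `Rˣ`.
-/

universe u v

namespace IsSemisimpleModule

variable {R : Type*} {M : Type*} [Ring R] [AddCommGroup M] [Module R M]

/-- If `D` is a submodule that surjects onto `M ⧸ I`, then the quotient map `M → M ⧸ I` has a
section with values in `D`. -/
theorem exists_mkQ_comp_eq_id_of_sup_eq_top [IsSemisimpleModule R M] {I D : Submodule R M}
    (h : I ⊔ D = ⊤) :
    ∃ s : M ⧸ I →ₗ[R] M, LinearMap.range s ≤ D ∧ I.mkQ ∘ₗ s = LinearMap.id := by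
  have surj : Function.Surjective (I.mkQ ∘ₗ D.subtype) := by
    intro q
    obtain ⟨m, rfl⟩ := I.mkQ_surjective q
    obtain ⟨i, hi, d, hd, rfl⟩ := Submodule.mem_sup.1 (h ▸ Submodule.mem_top : m ∈ I ⊔ D)
    refine ⟨⟨d, hd⟩, ?_⟩
    have : I.mkQ i = 0 := by simpa using hi
    rw [map_add, this, zero_add]
    rfl
  obtain ⟨s, hs⟩ := lifting_property _ surj LinearMap.id
  refine ⟨D.subtype ∘ₗ s, ?_, hs⟩
  rintro _ ⟨z, rfl⟩
  exact (s z).2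

/-- A noninjective endomorphism `f` of a Noetherian semisimple module has a homomorphism from its
kernel whose image is not contained in the range of `f`. -/
theorem exists_not_range_le_range [IsSemisimpleModule R M] [IsNoetherian R M] {f : M →ₗ[R] M}
    (hf : LinearMap.ker f ≠ ⊥) :
    ∃ φ : LinearMap.ker f →ₗ[R] M, ¬ LinearMap.range φ ≤ LinearMap.range f := by
  by_contra! H
  have lift (φ : LinearMap.ker f →ₗ[R] M) : ∃ ψ : LinearMap.ker f →ₗ[R] M, f ∘ₗ ψ = φ := by
    obtain ⟨ψ, hψ⟩ := lifting_property f.rangeRestrict f.surjective_rangeRestrict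
      (φ.codRestrict (LinearMap.range f) fun z ↦ H φ ⟨z, rfl⟩)
    exact ⟨ψ, LinearMap.ext fun z ↦ congr(($hψ z : M))⟩
  have iter (n : ℕ) : ∃ ψ : LinearMap.ker f →ₗ[R] M, (f ^ n) ∘ₗ ψ = (LinearMap.ker f).subtype := by
    induction n with
    | zero => exact ⟨(LinearMap.ker f).subtype, rfl⟩
    | succ n ih =>
      obtain ⟨φ, hφ⟩ := ih
      obtain ⟨ψ, rfl⟩ := lift φ
      exact ⟨ψ, by rw [← hφ, pow_succ]; rfl⟩
  obtain ⟨n, hn⟩ := monotone_stabilizes_iff_noetherian.2 ‹IsNoetherian R M› f.iterateKer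
  obtain ⟨ψ, hψ⟩ := iter n
  refine hf (eq_bot_iff.2 fun z hz ↦ ?_)
  have key : (f ^ n) (ψ ⟨z, hz⟩) = z := congr($hψ ⟨z, hz⟩)
  have mem : ψ ⟨z, hz⟩ ∈ LinearMap.ker (f ^ (n + 1)) := by
    rw [LinearMap.mem_ker, pow_succ', Module.End.mul_apply, key]
    exact hz
  have eq : LinearMap.ker (f ^ n) = LinearMap.ker (f ^ (n + 1)) := hn (n + 1) n.le_succ
  rw [← eq, LinearMap.mem_ker, key] at mem
  exact mem

/-- An endomorphism of a semisimple module of finite length becomes bijective after adding an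
endomorphism with values in any given submodule that spans the module together with the range. -/
theorem exists_bijective_add [IsSemisimpleModule R M] [IsNoetherian R M] [IsArtinian R M]
    (D : Submodule R M) (f : M →ₗ[R] M) (h : LinearMap.range f ⊔ D = ⊤) :
    ∃ g : M →ₗ[R] M, LinearMap.range g ≤ D ∧ Function.Bijective (f + g) := by
  induction hK : LinearMap.ker f using WellFoundedLT.induction generalizing f with
  | ind K ih =>
  subst hK
  by_cases hf : LinearMap.ker f = ⊥
  · refine ⟨0, by simp, ?_⟩
    rw [add_zero]
    exact IsArtinian.bijective_of_injective_endomorphism f (LinearMap.ker_eq_bot.1 hf)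
  obtain ⟨φ, hφ⟩ := exists_not_range_le_range hf
  obtain ⟨s, hsD, hs⟩ := exists_mkQ_comp_eq_id_of_sup_eq_top h
  obtain ⟨r, hr⟩ := extension_property (LinearMap.ker f).subtype
    (LinearMap.ker f).subtype_injective LinearMap.id
  let q := (LinearMap.range f).mkQ
  let g : M →ₗ[R] M := s ∘ₗ q ∘ₗ φ ∘ₗ r
  have hqs (z) : q (s z) = z := congr($hs z)
  have hgD (z : M) : g z ∈ D := hsD ⟨_, rfl⟩
  have hle : LinearMap.ker (f + g) ≤ LinearMap.ker f := by
    intro z hz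
    have hz' : f z + s (q (φ (r z))) = 0 := hz
    have hqf : q (f z) = 0 := by simp [q]
    have hq : q (φ (r z)) = 0 := by simpa [hqf, hqs] using congr(q $hz')
    simpa [hq] using hz'
  have hlt : LinearMap.ker (f + g) < LinearMap.ker f := by
    refine lt_of_le_of_ne hle fun heq ↦ hφ ?_
    rintro _ ⟨k, rfl⟩
    have hk : (f + g) k = 0 := heq.ge k.2
    have hfk : f k = 0 := k.2
    have hrk : r k = k := congr($hr k)
    have hsq : s (q (φ k)) = 0 := by simpa [hfk, g, hrk] using hk
    have hq : q (φ k) = 0 := by rw [← hqs (q (φ k)), hsq, map_zero]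
    simpa [q] using hq
  have htop : LinearMap.range (f + g) ⊔ D = ⊤ := by
    refine top_unique (h ▸ sup_le ?_ le_sup_right)
    rintro _ ⟨z, rfl⟩
    exact Submodule.mem_sup.2 ⟨(f + g) z, ⟨z, rfl⟩, -g z, D.neg_mem (hgD z), by simp⟩
  obtain ⟨g', hg'D, hg'⟩ := ih _ hlt (f + g) htop rfl
  refine ⟨g + g', ?_, by rwa [← add_assoc]⟩
  rintro _ ⟨z, rfl⟩
  exact D.add_mem (hgD z) (hg'D ⟨z, rfl⟩)

end IsSemisimpleModule

/-- A semisimple ring has left stable range one. -/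
theorem IsSemisimpleRing.exists_isUnit_add_mul {R : Type*} [Ring R] [IsSemisimpleRing R]
    {a b d e : R} (h : b * a + e * d = 1) : ∃ c : R, IsUnit (a + c * d) := by
  have hsup : LinearMap.range (LinearMap.toSpanSingleton R R a) ⊔ Ideal.span {d} = ⊤ := by
    rw [Ideal.eq_top_iff_one, ← h]
    exact Submodule.add_mem_sup ⟨b, rfl⟩ (Ideal.mem_span_singleton'.2 ⟨e, rfl⟩)
  obtain ⟨g, hgD, hg⟩ := IsSemisimpleModule.exists_bijective_add _ _ hsup
  obtain ⟨c, hc⟩ := Ideal.mem_span_singleton'.1 (hgD ⟨1, rfl⟩)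
  refine ⟨c, ?_⟩
  have hmul (z : R) : (LinearMap.toSpanSingleton R R a + g) z = z * (a + c * d) := by
    have := map_smul g z 1
    rw [smul_eq_mul, smul_eq_mul, mul_one] at this
    rw [hc, mul_add, ← this]
    rfl
  obtain ⟨w, hw⟩ := hg.2 1
  rw [hmul] at hw
  refine isUnit_iff_exists.2 ⟨w, hg.1 ?_, hw⟩
  rw [hmul, hmul, mul_assoc, hw, mul_one, one_mul]

namespace Ideal

variable {R : Type*} [Ring R]

/-- An element congruent to `1` modulo the Jacobson radical of a ring is a unit. -/
theorem isUnit_of_sub_one_mem_jacobson (r : R) (h : r - 1 ∈ jacobson (⊥ : Ideal R)) :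
    IsUnit r := by
  obtain ⟨s, hs⟩ := exists_mul_sub_mem_of_sub_one_mem_jacobson r h
  rw [mem_bot, sub_eq_zero] at hs
  have hs1 : s - 1 ∈ jacobson (⊥ : Ideal R) := by
    have : s - 1 = -(s * (r - 1)) := by rw [mul_sub, hs, mul_one, neg_sub]
    exact this ▸ neg_mem (mul_mem_left _ s h)
  obtain ⟨t, ht⟩ := exists_mul_sub_mem_of_sub_one_mem_jacobson s hs1
  rw [mem_bot, sub_eq_zero] at ht
  exact isUnit_iff_exists.2 ⟨s, left_inv_eq_right_inv ht hs ▸ ht, hs⟩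

/-- An element that is a unit modulo the Jacobson radical of a ring is a unit. -/
theorem isUnit_of_isUnit_mk_jacobson {v : R}
    (h : IsUnit (Quotient.mk (jacobson (⊥ : Ideal R)) v)) : IsUnit v := by
  obtain ⟨w, hvw, hwv⟩ := isUnit_iff_exists.1 h
  obtain ⟨w, rfl⟩ := Quotient.mk_surjective w
  rw [← map_mul, ← map_one (Quotient.mk _), Quotient.mk_eq_mk_iff_sub_mem] at hvw hwv
  obtain ⟨s, hs⟩ := (isUnit_of_sub_one_mem_jacobson _ hvw).exists_right_inv
  obtain ⟨t, ht⟩ := (isUnit_of_sub_one_mem_jacobson _ hwv).exists_left_inv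
  rw [mul_assoc] at hs
  rw [← mul_assoc] at ht
  exact isUnit_iff_exists.2 ⟨w * s, hs, left_inv_eq_right_inv ht hs ▸ ht⟩

/-- A semilocal ring has left stable range one. -/
theorem exists_isUnit_add_mul_of_isSemisimpleModule_quotient_jacobson
    (hR : IsSemisimpleModule R (R ⧸ jacobson (⊥ : Ideal R)))
    {a b d e : R} (h : b * a + e * d = 1) : ∃ c : R, IsUnit (a + c * d) := by
  let J := jacobson (⊥ : Ideal R)
  have : RingHomSurjective (Quotient.mk J) := ⟨Quotient.mk_surjective⟩
  let f : R ⧸ J →ₛₗ[Quotient.mk J] R ⧸ J :=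
    { AddMonoidHom.id (R ⧸ J) with
      map_smul' := fun r z ↦ by
        obtain ⟨z, rfl⟩ := Quotient.mk_surjective z
        rfl }
  have : IsSemisimpleRing (R ⧸ J) :=
    (f.isSemisimpleModule_iff_of_bijective Function.bijective_id).1 hR
  obtain ⟨c, hc⟩ := IsSemisimpleRing.exists_isUnit_add_mul
    (a := Quotient.mk J a) (b := Quotient.mk J b) (d := Quotient.mk J d) (e := Quotient.mk J e)
    (by rw [← map_mul, ← map_mul, ← map_add, h, map_one])
  obtain ⟨c, rfl⟩ := Quotient.mk_surjective c
  exact ⟨c, isUnit_of_isUnit_mk_jacobson (by rwa [map_add, map_mul])⟩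

end Ideal

theorem exists_unit_smul_eq_of_span_singleton_eq
    (R : Type u) [Ring R]
    (hsemilocal : IsSemisimpleModule R (R ⧸ Ideal.jacobson (⊥ : Ideal R)))
    (M : Type v) [AddCommGroup M] [Module R M] (x y : M)
    (h : Submodule.span R {x} = Submodule.span R {y}) :
    ∃ u : Rˣ, x = u • y := by
  obtain ⟨a, rfl⟩ := Submodule.mem_span_singleton.1 (h ▸ Submodule.mem_span_singleton_self x)
  obtain ⟨b, hb⟩ := Submodule.mem_span_singleton.1 (h.symm ▸ Submodule.mem_span_singleton_self y)
  obtain ⟨c, u, hu⟩ := Ideal.exists_isUnit_add_mul_of_isSemisimpleModule_quotient_jacobson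
    hsemilocal (a := a) (b := b) (d := 1 - b * a) (e := 1) (by rw [one_mul, add_sub_cancel])
  refine ⟨u, ?_⟩
  rw [Units.smul_def, hu, add_smul, mul_smul, sub_smul, mul_smul, hb, one_smul, sub_self,
    smul_zero, add_zero]
end

section
/- Let K be an infinite field, A a finite-dimensional K-algebra and M a left A-module. Then the following are equivalent: (1) the action of the group of units Aˣ on M by scalar multiplication has finitely many orbits; (2) M has only finitely many submodules; (3) M is distributive. -/
/-!
STATEMENT 4: For an infinite field `K`, a finite-dimensional `K`-algebra `A` and a
left `A`-module `M`, the following are equivalent: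
(1) the action of `Aˣ` on `M` has finitely many orbits;
(2) `M` has only finitely many submodules;
(3) `M` is distributive (its lattice of submodules is distributive).
-/

universe u v w

theorem spectrum.finite_of_finiteDimensional (K : Type*) {A : Type*} [Field K] [Ring A]
    [Algebra K A] [FiniteDimensional K A] (a : A) : (spectrum K a).Finite := by
  nontriviality A
  refine (minpoly K a).rootSet_finite K |>.subset fun r hr ↦ ?_
  have hmem := spectrum.subset_polynomial_aeval a (minpoly K a) ⟨r, hr, rfl⟩
  rw [minpoly.aeval, spectrum.zero_eq, Set.mem_singleton_iff] at hmem
  rw [Polynomial.mem_rootSet]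
  exact ⟨minpoly.ne_zero (Algebra.IsIntegral.isIntegral a), by simpa using hmem⟩

/-- Two generators of the same cyclic module over a finite-dimensional algebra over an infinite
field differ by a unit. -/
theorem exists_units_smul_eq_of_span_singleton_eq (K : Type*) {A M : Type*} [Field K] [Infinite K]
    [Ring A] [Algebra K A] [FiniteDimensional K A] [AddCommGroup M] [Module A M] {x y : M}
    (h : Submodule.span A {x} = Submodule.span A {y}) : ∃ u : Aˣ, u • x = y := by
  obtain ⟨a, rfl⟩ := Submodule.mem_span_singleton.1 (h ▸ Submodule.mem_span_singleton_self y)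
  obtain ⟨b, hb⟩ := Submodule.mem_span_singleton.1 (h ▸ Submodule.mem_span_singleton_self x)
  have hfin : (({0} ∪ spectrum K a) ∪ (·⁻¹) ⁻¹' spectrum K b).Finite :=
    ((Set.finite_singleton 0).union (spectrum.finite_of_finiteDimensional K a)).union
      ((spectrum.finite_of_finiteDimensional K b).preimage inv_injective.injOn)
  obtain ⟨r, hr⟩ := hfin.exists_notMem
  simp only [Set.mem_union, Set.mem_singleton_iff, Set.mem_preimage, not_or] at hr
  obtain ⟨⟨hr0, hra⟩, hrb⟩ := hr
  obtain ⟨u, hu⟩ := spectrum.notMem_iff.1 hra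
  obtain ⟨v, hv⟩ := spectrum.notMem_iff.1 hrb
  let c : Aˣ := Units.map (algebraMap K A).toMonoidHom (-Units.mk0 r hr0)
  refine ⟨(c * v)⁻¹ * u, ?_⟩
  rw [mul_smul, inv_smul_eq_iff, Units.smul_def, Units.smul_def, Units.val_mul, hu, hv]
  have hc : (c : A) = -algebraMap K A r := by simp [c]
  have hcr : algebraMap K A r * algebraMap K A r⁻¹ = 1 := by
    rw [← map_mul, mul_inv_cancel₀ hr0, map_one]
  rw [hc, mul_sub, neg_mul, hcr, sub_smul, sub_smul, mul_smul, hb]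
  simp only [neg_smul, one_smul]
  abel

theorem exists_mem_span_singleton_add_smul (K : Type*) {A M : Type*} [Field K] [Infinite K]
    [Ring A] [Algebra K A] [AddCommGroup M] [Module A M] [Finite (Submodule A M)] (x y : M) :
    ∃ r : K, x ∈ Submodule.span A {x + algebraMap K A r • y} ∧
      y ∈ Submodule.span A {x + algebraMap K A r • y} := by
  obtain ⟨r, s, hrs, h⟩ := Finite.exists_ne_map_eq_of_infinite
    fun r : K ↦ Submodule.span A {x + algebraMap K A r • y}
  set P := Submodule.span A {x + algebraMap K A r • y}
  have hr : x + algebraMap K A r • y ∈ P := Submodule.mem_span_singleton_self _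
  have hs : x + algebraMap K A s • y ∈ P := by
    rw [h]
    exact Submodule.mem_span_singleton_self _
  have hy : y ∈ P := by
    have := P.smul_mem (algebraMap K A (r - s)⁻¹) (P.sub_mem hr hs)
    rwa [add_sub_add_left_eq_sub, ← sub_smul, ← map_sub, ← mul_smul, ← map_mul,
      inv_mul_cancel₀ (sub_ne_zero.2 hrs), map_one, one_smul] at this
  exact ⟨r, by simpa using P.sub_mem hr (P.smul_mem (algebraMap K A r) hy), hy⟩

theorem inf_sup_eq_of_finite_submodule (K : Type*) {A M : Type*} [Field K] [Infinite K]
    [Ring A] [Algebra K A] [AddCommGroup M] [Module A M] [Finite (Submodule A M)]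
    (N L L' : Submodule A M) : N ⊓ (L ⊔ L') = (N ⊓ L) ⊔ (N ⊓ L') := by
  refine le_antisymm ?_ le_inf_sup
  rintro _ ⟨hN, hL⟩
  obtain ⟨l, hl, l', hl', rfl⟩ := Submodule.mem_sup.1 hL
  obtain ⟨r, -, h⟩ := exists_mem_span_singleton_add_smul K l l' (A := A)
  obtain ⟨b, hb⟩ := Submodule.mem_span_singleton.1 h
  set c := algebraMap K A r
  have hcomm : c * b = b * c := Algebra.commutes r b
  have h₁ : (1 - c * b) • l' = b • l := by
    rw [sub_smul, one_smul, sub_eq_iff_eq_add, hcomm, mul_smul, ← smul_add, hb]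
  have h₂ : (c * b) • l = c • (1 - c * b) • l' := by rw [h₁, mul_smul]
  refine Submodule.mem_sup.2 ⟨(1 - c * b) • (l + l'), ⟨N.smul_mem _ hN, ?_⟩,
    (c * b) • (l + l'), ⟨N.smul_mem _ hN, ?_⟩, by rw [← add_smul, sub_add_cancel, one_smul]⟩
  · rw [smul_add, h₁]
    exact L.add_mem (L.smul_mem _ hl) (L.smul_mem _ hl)
  · rw [smul_add, h₂]
    exact L'.add_mem (L'.smul_mem _ (L'.smul_mem _ hl')) (L'.smul_mem _ hl')

/-- A distributive lattice satisfying both chain conditions is finite. -/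
theorem DistribLattice.finite_of_wellFounded (α : Type*) [DistribLattice α] [BoundedOrder α]
    [WellFoundedLT α] [WellFoundedGT α] : Finite α := by
  obtain ⟨a, ha : (Set.Iic a).Finite, hmax⟩ :=
    (wellFounded_gt (α := α)).has_min {a | (Set.Iic a).Finite} ⟨⊥, by simp⟩
  by_cases htop : IsMax a
  · rw [htop.eq_top, Set.Iic_top] at ha
    exact Set.finite_univ_iff.1 ha
  obtain ⟨b, hab⟩ := exists_covBy_of_wellFoundedLT htop
  refine absurd hab.lt (hmax b ?_)
  refine Set.Finite.of_injOn (f := fun x ↦ (x ⊓ a, x ⊔ a)) (t := Set.Iic a ×ˢ {a, b}) ?_ ?_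
    (ha.prod (Set.toFinite _))
  · intro x hx
    exact ⟨inf_le_right, hab.eq_or_eq le_sup_right (sup_le hx hab.le)⟩
  · intro x _ y _ hxy
    simp only [Prod.mk.injEq] at hxy
    exact eq_of_inf_eq_sup_eq hxy.1 hxy.2

theorem Submodule.finite_of_inf_sup_eq {A M : Type*} [Ring A] [AddCommGroup M] [Module A M]
    [IsNoetherian A M] [IsArtinian A M]
    (h : ∀ N L L' : Submodule A M, N ⊓ (L ⊔ L') = (N ⊓ L) ⊔ (N ⊓ L')) :
    Finite (Submodule A M) :=
  let _ : DistribLattice (Submodule A M) := .ofInfSupLe fun N L L' ↦ (h N L L').le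
  DistribLattice.finite_of_wellFounded (Submodule A M)

theorem Submodule.inf_sup_eq_submodule {A M : Type*} [Ring A] [AddCommGroup M] [Module A M]
    (h : ∀ N L L' : Submodule A M, N ⊓ (L ⊔ L') = (N ⊓ L) ⊔ (N ⊓ L')) (P : Submodule A M)
    (N L L' : Submodule A P) : N ⊓ (L ⊔ L') = (N ⊓ L) ⊔ (N ⊓ L') := by
  have hinj := P.injective_subtype
  apply Submodule.map_injective_of_injective hinj
  simp only [Submodule.map_sup, Submodule.map_inf _ hinj, h]

/-- If any two elements lie in a common cyclic submodule, a module over an Artinian and Noetherian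
ring is cyclic. -/
theorem Submodule.exists_span_singleton_eq_top {A M : Type*} [Ring A] [IsNoetherianRing A]
    [IsArtinianRing A] [AddCommGroup M] [Module A M]
    (h : ∀ x y : M, ∃ z, x ∈ Submodule.span A {z} ∧ y ∈ Submodule.span A {z}) :
    ∃ x : M, Submodule.span A {x} = ⊤ := by
  have hbdd (x : M) : Module.length A (Submodule.span A {x}) ≤ Module.length A A := by
    rw [← LinearMap.range_toSpanSingleton]
    exact Module.length_le_of_surjective _ (LinearMap.surjective_rangeRestrict _)
  have hA : Module.length A A ≠ ⊤ := Module.length_ne_top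
  let f (x : M) : ℕ := (Module.length A A).toNat - (Module.length A (Submodule.span A {x})).toNat
  refine ⟨Function.argmin f, eq_top_iff.2 fun y _ ↦ ?_⟩
  set x := Function.argmin f
  obtain ⟨z, hxz, hyz⟩ := h x y
  have hle : Submodule.span A {x} ≤ Submodule.span A {z} := by simpa using hxz
  obtain heq | hlt := hle.eq_or_lt
  · rwa [heq]
  refine absurd (Function.argmin_le f z) (not_le_of_gt ?_)
  have hlen : Module.length A (Submodule.span A {x}) < Module.length A (Submodule.span A {z}) := by
    rw [Module.length_submodule, Module.length_submodule]
    refine Order.height_strictMono hlt ?_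
    rw [← Module.length_submodule]
    exact lt_top_iff_ne_top.2 Module.length_ne_top
  have hz := ENat.toNat_le_toNat (hbdd z) hA
  rw [← ENat.natCast_toNat hlen.ne_top, ← ENat.natCast_toNat (Module.length_ne_top (R := A)
    (M := Submodule.span A {z})), Nat.cast_lt] at hlen
  change f z < f x
  simp only [f]
  omega

theorem finite_orbits_tfae_distributive
    (K : Type u) [Field K] [Infinite K]
    (A : Type v) [Ring A] [Algebra K A] [FiniteDimensional K A]
    (M : Type w) [AddCommGroup M] [Module A M] :
    List.TFAE
      [Finite (MulAction.orbitRel.Quotient Aˣ M),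
       Finite (Submodule A M),
       ∀ N L L' : Submodule A M, N ⊓ (L ⊔ L') = (N ⊓ L) ⊔ (N ⊓ L')] := by
  have : IsNoetherianRing A := .of_finite K A
  have : IsArtinianRing A := .of_finite K A
  tfae_have 1 → 2 := fun _ ↦ by
    have key (N L : Submodule A M) (h : Quotient.mk (MulAction.orbitRel Aˣ M) '' N =
        Quotient.mk (MulAction.orbitRel Aˣ M) '' L) : N ≤ L := fun x hx ↦ by
      obtain ⟨y, hy, hyx⟩ := h.le ⟨x, hx, rfl⟩
      obtain ⟨u, rfl⟩ := MulAction.orbitRel_apply.1 (Quotient.exact hyx.symm)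
      exact L.smul_mem (u : A) hy
    exact Finite.of_injective (β := Set (MulAction.orbitRel.Quotient Aˣ M))
      (fun N : Submodule A M ↦ Quotient.mk (MulAction.orbitRel Aˣ M) '' N)
      fun N L h ↦ le_antisymm (key N L h) (key L N h.symm)
  tfae_have 2 → 1 := fun _ ↦ by
    refine Finite.of_injective (fun q : MulAction.orbitRel.Quotient Aˣ M ↦
      Submodule.span A {Quotient.out q}) fun p q h ↦ ?_
    obtain ⟨u, hu⟩ := exists_units_smul_eq_of_span_singleton_eq K h
    exact (Quotient.out_equiv_out.1 (MulAction.orbitRel_apply.2 ⟨u, hu⟩)).symm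
  tfae_have 2 → 3 := fun _ ↦ inf_sup_eq_of_finite_submodule K
  tfae_have 3 → 2 := fun h ↦ by
    obtain ⟨x, hx⟩ := Submodule.exists_span_singleton_eq_top (A := A) (M := M) fun x y ↦ by
      let P := Submodule.span A {x, y}
      have : Module.Finite A P := Module.Finite.span_of_finite A (Set.toFinite _)
      have := Submodule.finite_of_inf_sup_eq (Submodule.inf_sup_eq_submodule h P)
      obtain ⟨r, h₁, h₂⟩ := exists_mem_span_singleton_add_smul K (A := A)
        (⟨x, Submodule.subset_span (by simp)⟩ : P) ⟨y, Submodule.subset_span (by simp)⟩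
      refine ⟨x + algebraMap K A r • y, ?_, ?_⟩
      · simpa using Submodule.mem_map_of_mem (f := P.subtype) h₁
      · simpa using Submodule.mem_map_of_mem (f := P.subtype) h₂
    have : Module.Finite A M := ⟨⟨{x}, by simpa using hx⟩⟩
    exact Submodule.finite_of_inf_sup_eq h
  tfae_finish
end

section
/- Let R be a left artinian ring and M a left R-module such that every proper submodule N of M has infinite quotient M/N (equivalently, M has no nonzero finite factor module). Then the following are equivalent: (1) the action of the group of units Rˣ on M has finitely many orbits; (2) M has only finitely many submodules; (3) M is artinian and distributive. -/
/-!
STATEMENT 5: Let `R` be a left artinian ring and `M` a left `R`-module with no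
nonzero finite factor module (every proper submodule `N` has `M/N` infinite).
Then the following are equivalent:
(1) the action of `Rˣ` on `M` has finitely many orbits;
(2) `M` has only finitely many submodules;
(3) `M` is artinian and distributive.
-/

universe u v

section StableRange

/-- A ring has left stable range one if every relation `x * a + y * b = 1` can be shortened to a
unit of the form `a + t * b`. -/
def HasStableRangeOne (A : Type*) [Ring A] : Prop :=
  ∀ a b x y : A, x * a + y * b = 1 → ∃ t, IsUnit (a + t * b)

theorem HasStableRangeOne.of_ringEquiv {A B : Type*} [Ring A] [Ring B] (e : A ≃+* B)
    (hB : HasStableRangeOne B) : HasStableRangeOne A := by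
  intro a b x y h
  obtain ⟨t, ht⟩ := hB (e a) (e b) (e x) (e y) (by simp only [← map_mul, ← map_add, h, map_one])
  refine ⟨e.symm t, ?_⟩
  have := ht.map e.symm
  simpa using this

theorem HasStableRangeOne.pi {ι : Type*} {A : ι → Type*} [∀ i, Ring (A i)]
    (hA : ∀ i, HasStableRangeOne (A i)) : HasStableRangeOne (∀ i, A i) := by
  intro a b x y h
  choose t ht using fun i ↦ hA i (a i) (b i) (x i) (y i) (congrFun h i)
  exact ⟨t, Pi.isUnit_iff.mpr ht⟩

/-- If `f` and `g` have jointly full image, then `f` can be corrected through `g` to an injective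
map. -/
theorem LinearMap.exists_injective_add_comp {D V : Type*} [DivisionRing D] [AddCommGroup V]
    [Module D V] [FiniteDimensional D V] (f g : V →ₗ[D] V)
    (h : LinearMap.range f ⊔ LinearMap.range g = ⊤) :
    ∃ t : V →ₗ[D] V, Function.Injective (f + g ∘ₗ t) := by
  obtain ⟨C, hCg, hC⟩ : ∃ C ≤ LinearMap.range g, IsCompl (LinearMap.range f) C := by
    obtain ⟨C', hC'⟩ := exists_isCompl
      ((LinearMap.range f ⊓ LinearMap.range g).submoduleOf (LinearMap.range g))
    refine ⟨C'.map (LinearMap.range g).subtype, Submodule.map_subtype_le _ _, ?_, ?_⟩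
    · rw [Submodule.disjoint_def]
      rintro _ hx ⟨y, hy, rfl⟩
      have := Submodule.disjoint_def.mp hC'.disjoint y ⟨hx, y.2⟩ hy
      simp [this]
    · rw [codisjoint_iff, eq_top_iff, ← h]
      refine sup_le le_sup_left fun x hx ↦ ?_
      have hx' : (⟨x, hx⟩ : LinearMap.range g) ∈ _ ⊔ C' := hC'.sup_eq_top ▸ Submodule.mem_top
      obtain ⟨p, hp, q, hq, hpq⟩ := Submodule.mem_sup.mp hx'
      exact Submodule.mem_sup.mpr ⟨p, hp.1, q, ⟨q, hq, rfl⟩, congrArg Subtype.val hpq⟩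
  have hdim : Module.finrank D (LinearMap.ker f) = Module.finrank D C := by
    have h1 := f.finrank_range_add_finrank_ker
    have h2 := Submodule.finrank_add_eq_of_isCompl hC
    omega
  let θ := LinearEquiv.ofFinrankEq _ _ hdim
  obtain ⟨π, hπ⟩ := (LinearMap.ker f).subtype.exists_leftInverse_of_injective
    (Submodule.ker_subtype _)
  obtain ⟨t, ht⟩ := Module.projective_lifting_property g.rangeRestrict
    (Submodule.inclusion hCg ∘ₗ θ.toLinearMap ∘ₗ π) g.surjective_rangeRestrict
  have ht' (v : V) : g (t v) = θ (π v) := congrArg Subtype.val (LinearMap.congr_fun ht v)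
  refine ⟨t, (injective_iff_map_eq_zero _).mpr fun v hv ↦ ?_⟩
  rw [LinearMap.add_apply, LinearMap.comp_apply, ht'] at hv
  have h1 : ((θ (π v) : C) : V) = 0 :=
    Submodule.disjoint_def.mp hC.disjoint _
      (by rw [← neg_eq_of_add_eq_zero_right hv]; exact neg_mem ⟨v, rfl⟩) (θ (π v)).2
  have h2 : π v = 0 := by simpa using h1
  have h3 : v ∈ LinearMap.ker f := by simpa [h1] using hv
  have h4 : π v = ⟨v, h3⟩ := LinearMap.congr_fun hπ ⟨v, h3⟩
  exact congrArg Subtype.val (h4.symm.trans h2)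

theorem HasStableRangeOne.matrix {D n : Type*} [DivisionRing D] [Fintype n] [DecidableEq n] :
    HasStableRangeOne (Matrix n n D) := by
  intro a b x y h
  obtain ⟨t, ht⟩ := LinearMap.exists_injective_add_comp a.toLinearMapRight' b.toLinearMapRight' <| by
    refine eq_top_iff.mpr fun v _ ↦ ?_
    have hv : Matrix.vecMul (Matrix.vecMul v x) a + Matrix.vecMul (Matrix.vecMul v y) b = v := by
      rw [Matrix.vecMul_vecMul, Matrix.vecMul_vecMul, ← Matrix.vecMul_add, h, Matrix.vecMul_one]
    rw [← hv]
    exact Submodule.add_mem_sup ⟨_, rfl⟩ ⟨_, rfl⟩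
  let e := LinearEquiv.ofInjectiveEndo _ ht
  refine ⟨LinearMap.toMatrixRight' t, ?_⟩
  have h1 : (a + LinearMap.toMatrixRight' t * b).toLinearMapRight' = e.toLinearMap := by
    rw [map_add, Matrix.toLinearMapRight'_mul, Matrix.toLinearMapRight',
      LinearEquiv.symm_apply_apply]
    exact LinearMap.ext fun v ↦ rfl
  refine ⟨⟨_, LinearMap.toMatrixRight' e.symm.toLinearMap, ?_, ?_⟩, rfl⟩ <;>
  · apply Matrix.toLinearMapRight'.injective
    rw [Matrix.toLinearMapRight'_mul, h1]
    ext v : 1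
    simp

theorem HasStableRangeOne.of_isSemisimpleRing (A : Type*) [Ring A] [IsSemisimpleRing A] :
    HasStableRangeOne A := by
  obtain ⟨_, _, _, _, _, ⟨e⟩⟩ := IsSemisimpleRing.exists_ringEquiv_pi_matrix_divisionRing A
  exact .of_ringEquiv e (.pi fun _ ↦ .matrix)

theorem isUnit_of_isUnit_mk_jacobson {A : Type*} [Ring A] [IsSemiprimaryRing A] {a : A}
    (ha : IsUnit (Ideal.Quotient.mk (Ring.jacobson A) a)) : IsUnit a := by
  have key (c : A) (hc : Ideal.Quotient.mk (Ring.jacobson A) c = 1) : IsUnit c := by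
    obtain ⟨n, hn⟩ := IsSemiprimaryRing.isNilpotent (R := A)
    have h1 : 1 - c ∈ Ring.jacobson A := by
      rw [← Ideal.Quotient.eq_zero_iff_mem, map_sub, hc, map_one, sub_self]
    have h2 : IsNilpotent (1 - c) := ⟨n, by
      have := Ideal.pow_mem_pow h1 n
      rwa [hn] at this⟩
    simpa using h2.isUnit_one_sub
  obtain ⟨b', hb, hb'⟩ := isUnit_iff_exists.mp ha
  obtain ⟨b, rfl⟩ := Ideal.Quotient.mk_surjective b'
  obtain ⟨u, hu⟩ := key (a * b) (by rw [map_mul, hb])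
  obtain ⟨w, hw⟩ := key (b * a) (by rw [map_mul, hb'])
  refine isUnit_iff_exists_and_exists.mpr ⟨⟨b * ↑u⁻¹, ?_⟩, ⟨↑w⁻¹ * b, ?_⟩⟩
  · rw [← mul_assoc, ← hu, Units.mul_inv]
  · rw [mul_assoc, ← hw, Units.inv_mul]

theorem HasStableRangeOne.of_isSemiprimaryRing (A : Type*) [Ring A] [IsSemiprimaryRing A] :
    HasStableRangeOne A := by
  intro a b x y h
  let q := Ideal.Quotient.mk (Ring.jacobson A)
  obtain ⟨t', ht⟩ := HasStableRangeOne.of_isSemisimpleRing (A ⧸ Ring.jacobson A)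
    (q a) (q b) (q x) (q y) (by simp only [← map_mul, ← map_add, h, map_one])
  obtain ⟨t, rfl⟩ := Ideal.Quotient.mk_surjective t'
  exact ⟨t, isUnit_of_isUnit_mk_jacobson (by simpa using ht)⟩

theorem HasStableRangeOne.exists_units_smul_eq {A N : Type*} [Ring A] [AddCommGroup N] [Module A N]
    (hA : HasStableRangeOne A) {m n : N} (h : Submodule.span A {m} = Submodule.span A {n}) :
    ∃ w : Aˣ, w • m = n := by
  obtain ⟨a, ha⟩ := Submodule.mem_span_singleton.mp (h ▸ Submodule.mem_span_singleton_self n)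
  obtain ⟨b, hb⟩ := Submodule.mem_span_singleton.mp (h ▸ Submodule.mem_span_singleton_self m)
  obtain ⟨t, w, hw⟩ := hA a (1 - b * a) b 1 (by noncomm_ring)
  refine ⟨w, ?_⟩
  rw [Units.smul_def, hw, add_smul, mul_smul, sub_smul, mul_smul, ha, hb, one_smul, sub_self,
    smul_zero, add_zero]

end StableRange

section FiniteFactors

variable {R : Type*} [Ring R]

theorem Submodule.finite_quotient_of_map_eq {M T : Type*} [AddCommGroup M] [Module R M] [Finite T]
    (N : Submodule R M) (f : M → T) (hf : ∀ x y, f x = f y → x - y ∈ N) : Finite (M ⧸ N) := by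
  refine Finite.of_injective (fun q : M ⧸ N ↦ f q.out) fun p q h ↦ ?_
  have := (Submodule.Quotient.eq N).mpr (hf _ _ h)
  simpa only [Submodule.Quotient.mk, Quotient.out_eq] using this

theorem Submodule.FG.finite_image_mkQ_smul {M : Type*} [AddCommGroup M] [Module R M]
    {N : Submodule R M} (hN : N.FG) (I : Ideal R) [Finite (R ⧸ I)] :
    ((I • N).mkQ '' (N : Set M)).Finite := by
  obtain ⟨s, rfl⟩ := hN
  let f (c : s → R ⧸ I) : M ⧸ I • span R (s : Set M) :=
    ∑ i, (c i).out • (I • span R (s : Set M)).mkQ i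
  refine (Set.finite_range f).subset ?_
  rintro _ ⟨x, hx, rfl⟩
  obtain ⟨c, -, rfl⟩ := mem_span_finset'.mp hx
  refine ⟨fun i ↦ Submodule.Quotient.mk (c i), ?_⟩
  simp only [f, ← map_smul, ← map_sum]
  refine (Submodule.Quotient.eq _).mpr ?_
  rw [← Finset.sum_sub_distrib]
  refine sum_mem fun i _ ↦ ?_
  rw [← sub_smul]
  refine smul_mem_smul ((Submodule.Quotient.eq I).mp ?_) (subset_span i.2)
  exact Quotient.out_eq _

theorem Submodule.eq_bot_of_le_jacobson_smul [IsSemiprimaryRing R] {M : Type*} [AddCommGroup M]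
    [Module R M] {N : Submodule R M} (h : N ≤ Ring.jacobson R • N) : N = ⊥ := by
  obtain ⟨n, hn⟩ := IsSemiprimaryRing.isNilpotent (R := R)
  have key (k : ℕ) : N ≤ Ring.jacobson R ^ k • N := by
    induction k with
    | zero => simp [Submodule.pow_zero, Ideal.one_eq_top]
    | succ k ih =>
      rw [Submodule.pow_succ, Submodule.mul_smul]
      exact ih.trans (smul_mono_right _ h)
  simpa [hn] using key n

theorem Submodule.eq_top_of_sup_jacobson_smul [IsSemiprimaryRing R] {M : Type*} [AddCommGroup M]
    [Module R M] {N : Submodule R M} (h : N ⊔ Ring.jacobson R • ⊤ = ⊤) : N = ⊤ := by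
  obtain ⟨n, hn⟩ := IsSemiprimaryRing.isNilpotent (R := R)
  have key (k : ℕ) : N ⊔ Ring.jacobson R ^ k • ⊤ = ⊤ := by
    induction k with
    | zero => simp [Submodule.pow_zero, Ideal.one_eq_top]
    | succ k ih =>
      refine eq_top_iff.mpr (ih.ge.trans (sup_le le_sup_left ?_))
      calc Ring.jacobson R ^ k • (⊤ : Submodule R M)
          = Ring.jacobson R ^ k • N ⊔ Ring.jacobson R ^ k • Ring.jacobson R • ⊤ := by
            rw [← Submodule.smul_sup, h]
        _ ≤ N ⊔ Ring.jacobson R ^ (k + 1) • ⊤ := by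
            rw [Submodule.pow_succ, Submodule.mul_smul]
            exact sup_le_sup_right smul_le_right _
  simpa [hn] using key n

theorem isSemisimpleModule_of_jacobson_le_annihilator [IsSemiprimaryRing R] {M : Type*}
    [AddCommGroup M] [Module R M] (h : Ring.jacobson R ≤ Module.annihilator R M) :
    IsSemisimpleModule R M := by
  rw [← SetLike.coe_subset_coe, ← Module.isTorsionBySet_iff_subset_annihilator] at h
  let _ := h.module
  exact (h.semilinearMap.isSemisimpleModule_iff_of_bijective Function.bijective_id).2
    inferInstance

/-- A left ideal of finite index acts surjectively on a module without nonzero finite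
quotients. -/
theorem smul_top_eq_top_of_finite_quotient [IsSemiprimaryRing R] {M : Type*} [AddCommGroup M]
    [Module R M] (hM : ∀ N : Submodule R M, N ≠ ⊤ → Infinite (M ⧸ N)) (Q : Ideal R)
    [Finite (R ⧸ Q)] : Q • (⊤ : Submodule R M) = ⊤ := by
  refine Submodule.eq_top_of_sup_jacobson_smul ?_
  set N := Q • (⊤ : Submodule R M) ⊔ Ring.jacobson R • ⊤ with hN
  have : IsSemisimpleModule R (M ⧸ N) := by
    refine isSemisimpleModule_of_jacobson_le_annihilator fun r hr ↦ ?_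
    refine Module.mem_annihilator.mpr fun x ↦ ?_
    obtain ⟨x, rfl⟩ := N.mkQ_surjective x
    rw [← map_smul]
    exact (Submodule.Quotient.mk_eq_zero N).mpr
      ((le_sup_right : Ring.jacobson R • ⊤ ≤ N) (Submodule.smul_mem_smul hr trivial))
  by_contra hne
  have : Nontrivial (M ⧸ N) := Submodule.Quotient.nontrivial_iff.mpr hne
  obtain ⟨C', hC', -⟩ := (eq_top_or_exists_le_coatom (⊥ : Submodule R (M ⧸ N))).resolve_left
    bot_ne_top
  have hC : IsCoatom (C'.comap N.mkQ) :=
    (Submodule.isCoatom_comap_iff N.mkQ_surjective).mpr hC'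
  have hQC (x : M) : ∀ r ∈ Q, r • x ∈ C'.comap N.mkQ := fun r hr ↦ by
    have : N.mkQ (r • x) = 0 := (Submodule.Quotient.mk_eq_zero N).mpr
      ((le_sup_left : Q • ⊤ ≤ N) (Submodule.smul_mem_smul hr trivial))
    simp [this]
  set C := C'.comap N.mkQ
  have hinf := hM C hC.ne_top
  have : IsSimpleModule R (M ⧸ C) := isSimpleModule_iff_isCoatom.mpr hC
  obtain ⟨t, ht⟩ := exists_ne (0 : M ⧸ C)
  obtain ⟨t, rfl⟩ := C.mkQ_surjective t
  refine not_finite_iff_infinite.mpr hinf (Finite.of_surjective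
    (Q.liftQ (LinearMap.toSpanSingleton R (M ⧸ C) (C.mkQ t)) fun r hr ↦ ?_) ?_)
  · rw [LinearMap.mem_ker, LinearMap.toSpanSingleton_apply, ← map_smul]
    exact (Submodule.Quotient.mk_eq_zero C).mpr (hQC t r hr)
  · rw [← LinearMap.range_eq_top, Submodule.range_liftQ, LinearMap.range_eq_top]
    exact IsSimpleModule.toSpanSingleton_surjective R ht

theorem smul_top_le_smul_smul_top {M : Type*} [AddCommGroup M]
    [Module R M] (hM : ∀ Q : Ideal R, Q.IsTwoSided → Finite (R ⧸ Q) → Q • (⊤ : Submodule R M) = ⊤)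
    (I K : Ideal R) [I.IsTwoSided] [K.IsTwoSided] [Finite (R ⧸ I)] (hK : K.FG) :
    K • (⊤ : Submodule R M) ≤ (I * K) • (⊤ : Submodule R M) := by
  have hfin : ((I * K).mkQ '' (K : Set R)).Finite := Submodule.FG.finite_image_mkQ_smul hK I
  obtain ⟨s, hs⟩ := hK
  let Q : Ideal R :=
    { carrier := {r | ∀ k ∈ K, k * r ∈ I * K}
      add_mem' := fun ha hb k hk ↦ by rw [mul_add]; exact add_mem (ha k hk) (hb k hk)
      zero_mem' := fun k _ ↦ by simp
      smul_mem' := fun c r hr k hk ↦ by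
        rw [smul_eq_mul, ← mul_assoc]; exact hr _ (K.mul_mem_right c hk) }
  have hQ : Q.IsTwoSided := ⟨fun b ha k hk ↦ by
    rw [← mul_assoc]; exact Ideal.mul_mem_right b _ (ha k hk)⟩
  have : Finite ((I * K).mkQ '' (K : Set R)) := hfin
  have hsK (k : s) : (k : R) ∈ K := hs ▸ Submodule.subset_span k.2
  have : Finite (R ⧸ Q) := Submodule.finite_quotient_of_map_eq Q
    (fun r (k : s) ↦ (⟨(I * K).mkQ (k * r), _, K.mul_mem_right r (hsK k), rfl⟩ :
      (I * K).mkQ '' (K : Set R))) fun x y hxy k hk ↦ by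
    rw [← hs] at hk
    induction hk using Submodule.span_induction with
    | mem k hk =>
      have := congrArg Subtype.val (congrFun hxy ⟨k, hk⟩)
      rw [mul_sub]
      exact (Submodule.Quotient.eq _).mp this
    | zero => simp
    | add a b _ _ ha hb => rw [add_mul]; exact add_mem ha hb
    | smul c a _ ha => rw [smul_eq_mul, mul_assoc]; exact Ideal.mul_mem_left _ c ha
  have hKQ : K * Q ≤ I * K := Ideal.mul_le.mpr fun k hk r (hr : ∀ k ∈ K, k * r ∈ I * K) ↦ hr k hk
  calc K • (⊤ : Submodule R M) = (K * Q) • ⊤ := by rw [Submodule.mul_smul, hM Q hQ this]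
    _ ≤ (I * K) • ⊤ := Submodule.smul_mono_left hKQ

/-- In a semiprimary ring, every two-sided ideal is complemented modulo the radical. -/
theorem exists_isTwoSided_sup_eq_top_mul_le_jacobson [IsSemiprimaryRing R] (I : Ideal R)
    [I.IsTwoSided] : ∃ K : Ideal R, K.IsTwoSided ∧ I ⊔ K = ⊤ ∧ I * K ≤ Ring.jacobson R := by
  let J := Ring.jacobson R
  let K : Ideal R :=
    { carrier := {r | ∀ i ∈ I, i * r ∈ J}
      add_mem' := fun ha hb i hi ↦ by rw [mul_add]; exact add_mem (ha i hi) (hb i hi)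
      zero_mem' := fun i _ ↦ by simp
      smul_mem' := fun c r hr i hi ↦ by
        rw [smul_eq_mul, ← mul_assoc]; exact hr _ (I.mul_mem_right c hi) }
  refine ⟨K, ⟨fun b ha i hi ↦ ?_⟩, ?_,
    Ideal.mul_le.mpr fun i hi r (hr : ∀ i ∈ I, i * r ∈ J) ↦ hr i hi⟩
  · rw [← mul_assoc]
    exact Ideal.mul_mem_right b _ (ha i hi)
  have : IsSemisimpleModule R (R ⧸ J) := by
    refine isSemisimpleModule_of_jacobson_le_annihilator fun r hr ↦ ?_
    refine Module.mem_annihilator.mpr fun x ↦ ?_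
    obtain ⟨x, rfl⟩ := J.mkQ_surjective x
    rw [← map_smul]
    exact (Submodule.Quotient.mk_eq_zero J).mpr (J.mul_mem_right x hr)
  obtain ⟨C, hC⟩ := exists_isCompl (Submodule.map J.mkQ I)
  have hCK : C.comap J.mkQ ≤ K := fun c hc i hi ↦ by
    refine (Submodule.Quotient.mk_eq_zero J).mp
      (Submodule.disjoint_def.mp hC.disjoint (J.mkQ (i * c)) ⟨_, I.mul_mem_right c hi, rfl⟩ ?_)
    rw [← smul_eq_mul, map_smul]
    exact C.smul_mem i hc
  refine eq_top_iff.mpr (le_trans ?_ (sup_le_sup_left hCK I))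
  intro x _
  obtain ⟨_, ⟨i, hi, rfl⟩, c, hc, hic⟩ := Submodule.mem_sup.mp
    (hC.sup_eq_top ▸ Submodule.mem_top : J.mkQ x ∈ Submodule.map J.mkQ I ⊔ C)
  refine Submodule.mem_sup.mpr ⟨i, hi, x - i, ?_, by abel⟩
  rw [Submodule.mem_comap, map_sub, ← hic, add_sub_cancel_left]
  exact hc

/-- A module over an artinian ring without nonzero finite quotients has no nonzero finite
subquotients. -/
theorem not_ker_toSpanSingleton_le_of_finite_quotient [IsArtinianRing R] {M : Type*}
    [AddCommGroup M] [Module R M] (hM : ∀ N : Submodule R M, N ≠ ⊤ → Infinite (M ⧸ N))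
    (P : Ideal R) [Finite (R ⧸ P)] (hP : P ≠ ⊤) (m : M) :
    ¬ LinearMap.ker (LinearMap.toSpanSingleton R M m) ≤ P := by
  intro hm
  let I := Module.annihilator R (R ⧸ P)
  have hIP : I ≤ P := fun r hr ↦ by
    have := Module.mem_annihilator.mp hr (P.mkQ 1)
    rw [← map_smul] at this
    simpa using (Submodule.Quotient.mk_eq_zero P).mp this
  have : Finite (R ⧸ I) := Submodule.finite_quotient_of_map_eq I
    (fun r (x : R ⧸ P) ↦ r • x) fun a b hab ↦ Module.mem_annihilator.mpr fun x ↦ by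
      rw [sub_smul, sub_eq_zero]
      exact congrFun hab x
  obtain ⟨K₀, _, hIK₀, hK₀⟩ := exists_isTwoSided_sup_eq_top_mul_le_jacobson I
  obtain ⟨n, hn⟩ := IsArtinian.monotone_stabilizes (R := R) (M := R)
    ⟨fun n ↦ OrderDual.toDual (K₀ ^ n), fun a b hab ↦ Ideal.pow_le_pow_right hab⟩
  let K := K₀ ^ (n + 1)
  have hKK : K * K = K := by
    have h1 : K₀ ^ n = K₀ ^ (n + 1) := hn (n + 1) (by omega)
    have h2 : K₀ ^ n = K₀ ^ (n + 1 + (n + 1)) := hn (n + 1 + (n + 1)) (by omega)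
    rw [Ideal.IsTwoSided.pow_add, ← h1] at h2
    simp only [K, ← h1]
    exact h2.symm
  have hIK : I * K ≤ Ring.jacobson R * K := by
    calc I * K = I * K * K := by rw [mul_assoc, hKK]
      _ ≤ Ring.jacobson R * K := Ideal.mul_mono_left
        ((Ideal.mul_mono_right (Ideal.pow_le_self n.succ_ne_zero)).trans hK₀)
  have hbot : K • (⊤ : Submodule R M) = ⊥ := by
    refine Submodule.eq_bot_of_le_jacobson_smul ?_
    rw [← Submodule.mul_smul]
    exact (smul_top_le_smul_smul_top (fun Q _ _ ↦ smul_top_eq_top_of_finite_quotient hM Q) I K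
      (IsNoetherian.noetherian K)).trans (Submodule.smul_mono_left hIK)
  have hsup : I ⊔ K = ⊤ := Ideal.sup_pow_eq_top' hIK₀
  obtain ⟨i, hi, k, hk, hik⟩ := Submodule.mem_sup.mp (hsup ▸ Submodule.mem_top : (1 : R) ∈ I ⊔ K)
  have hkm : k • m = 0 := by
    simpa [hbot] using Submodule.smul_mem_smul hk (Submodule.mem_top : m ∈ (⊤ : Submodule R M))
  exact hP ((Ideal.eq_top_iff_one P).mpr (hik ▸ add_mem (hIP hi) (hm hkm)))

open scoped Classical in
/-- A simple module over an artinian ring is finite as soon as its endomorphism ring is. -/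
theorem IsSimpleModule.finite_of_finite_end [IsArtinianRing R] {S : Type*} [AddCommGroup S]
    [Module R S] [IsSimpleModule R S] [Finite (Module.End R S)] : Finite S := by
  obtain ⟨s, hs⟩ := Finset.exists_inf_le fun x : S ↦ LinearMap.ker (LinearMap.toSpanSingleton R S x)
  let φ : R →ₗ[R] s → S := LinearMap.pi fun x ↦ LinearMap.toSpanSingleton R S x
  refine Finite.of_surjective (fun h : s → Module.End R S ↦ ∑ x, h x x) fun y ↦ ?_
  have hφ : LinearMap.ker φ ≤ LinearMap.ker (LinearMap.toSpanSingleton R S y) := by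
    refine le_trans (fun r hr ↦ ?_) (hs y)
    exact (Submodule.mem_finsetInf).mpr fun x hx ↦ congrFun hr ⟨x, hx⟩
  obtain ⟨h, hh⟩ := IsSemisimpleModule.extension_property ((LinearMap.ker φ).liftQ φ le_rfl)
    (LinearMap.ker_eq_bot.mp (Submodule.ker_liftQ_eq_bot _ _ _ le_rfl))
    ((LinearMap.ker φ).liftQ _ hφ)
  refine ⟨fun x ↦ h ∘ₗ LinearMap.single R (fun _ ↦ S) x, ?_⟩
  have h1 : h (φ 1) = y := by
    simpa using LinearMap.congr_fun hh ((LinearMap.ker φ).mkQ 1)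
  have h2 : φ 1 = fun x : s ↦ (x : S) := by ext x; simp [φ]
  rw [← h1, h2]
  simp only [LinearMap.comp_apply, LinearMap.coe_single, ← map_sum]
  rw [Finset.univ_sum_single (fun x : s ↦ (x : S))]

end FiniteFactors

section Distributive

theorem finite_of_inf_sup_distrib {α : Type*} [Lattice α] [OrderTop α] [OrderBot α]
    [WellFoundedLT α] [WellFoundedGT α]
    (h : ∀ a b c : α, a ⊓ (b ⊔ c) = (a ⊓ b) ⊔ (a ⊓ c)) : Finite α := by
  suffices key : ∀ a : α, (Set.Iic a).Finite by
    have := key ⊤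
    rwa [Set.Iic_top, Set.finite_univ_iff] at this
  intro a
  induction a using WellFoundedLT.induction with
  | ind a ih =>
    obtain rfl | ha := eq_or_ne a ⊥
    · simp
    obtain ⟨b, hb⟩ := exists_covBy_of_wellFoundedGT (isMin_iff_eq_bot.not.mpr ha)
    have hfin := ih b hb.lt
    refine (hfin.union (Set.Finite.of_finite_image (s := {x | x ⊔ b = a}) (f := (· ⊓ b))
      (hfin.subset ?_) ?_)).subset fun x hx ↦ ?_
    · rintro _ ⟨x, -, rfl⟩
      exact inf_le_right
    · have aux (x y : α) (hx : x ⊔ b = a) (hy : y ⊔ b = a) (hxy : x ⊓ b = y ⊓ b) : x ≤ y := by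
        calc x = x ⊓ (y ⊔ b) := by rw [hy, ← hx, inf_sup_self]
          _ = (x ⊓ y) ⊔ (y ⊓ b) := by rw [h, hxy]
          _ ≤ y := sup_le inf_le_right inf_le_left
      exact fun x hx y hy hxy ↦ le_antisymm (aux x y hx hy hxy) (aux y x hy hx hxy.symm)
    · rcases hb.eq_or_eq le_sup_right (sup_le hx hb.le : x ⊔ b ≤ a) with hxb | hxb
      · exact Or.inl (sup_eq_right.mp hxb)
      · exact Or.inr hxb

variable {R M : Type*} [Ring R] [AddCommGroup M] [Module R M]

theorem Submodule.inf_sup_of_forall_exists_smul_mem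
    (h : ∀ m n : M, ∃ a b : R, a + b = 1 ∧ a • m ∈ span R {n} ∧ b • n ∈ span R {m})
    (N L L' : Submodule R M) : N ⊓ (L ⊔ L') = (N ⊓ L) ⊔ (N ⊓ L') := by
  refine le_antisymm ?_ le_inf_sup
  rintro x ⟨hxN, hx⟩
  obtain ⟨l, hl, l', hr, rfl⟩ := mem_sup.mp hx
  obtain ⟨a, b, hab, ha, hb⟩ := h l l'
  have ha' : a • l ∈ L' := (span_singleton_le_iff_mem _ _).mpr hr ha
  have hb' : b • l' ∈ L := (span_singleton_le_iff_mem _ _).mpr hl hb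
  rw [← one_smul R (l + l'), ← hab, add_smul, add_comm (a • _)]
  refine add_mem_sup ⟨N.smul_mem b hxN, ?_⟩ ⟨N.smul_mem a hxN, ?_⟩
  · rw [smul_add]; exact add_mem (L.smul_mem b hl) hb'
  · rw [smul_add]; exact add_mem ha' (L'.smul_mem a hr)

/-- If no `a` with `a • m ∈ R n` and no `b` with `b • n ∈ R m` lies outside `P`, then
`R m + R n` maps onto `(R ⧸ P)²`, so each endomorphism of `R ⧸ P` gives a submodule by its graph. -/
theorem finite_end_quotient_of_finite_submodule [Finite (Submodule R M)] (P : Ideal R) (m n : M)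
    (hm : ∀ a : R, a • m ∈ Submodule.span R {n} → a ∈ P)
    (hn : ∀ b : R, b • n ∈ Submodule.span R {m} → b ∈ P) : Finite (Module.End R (R ⧸ P)) := by
  let q : R × R →ₗ[R] M := (LinearMap.toSpanSingleton R M m).coprod (LinearMap.toSpanSingleton R M n)
  let g (d : Module.End R (R ⧸ P)) : R × R →ₗ[R] R ⧸ P :=
    P.mkQ ∘ₗ LinearMap.snd R R R - d ∘ₗ P.mkQ ∘ₗ LinearMap.fst R R R
  refine Finite.of_injective (fun d ↦ (LinearMap.ker (g d)).map q) fun d d' h ↦ ?_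
  obtain ⟨b, hb⟩ := P.mkQ_surjective (d (P.mkQ 1))
  have hmem : q (1, b) ∈ (LinearMap.ker (g d)).map q := ⟨(1, b), sub_eq_zero.mpr hb, rfl⟩
  rw [show (LinearMap.ker (g d)).map q = _ from h] at hmem
  obtain ⟨⟨a', b'⟩, hab, heq⟩ := hmem
  have heq' : a' • m + b' • n = m + b • n := by simpa [q] using heq
  have ha : 1 - a' ∈ P := hm _ <| Submodule.mem_span_singleton.mpr ⟨b' - b, by
    rw [sub_smul, sub_smul, one_smul, sub_eq_sub_iff_add_eq_add, add_comm]; exact heq'⟩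
  have hb2 : b - b' ∈ P := hn _ <| Submodule.mem_span_singleton.mpr ⟨a' - 1, by
    rw [sub_smul, sub_smul, one_smul, sub_eq_sub_iff_add_eq_add, heq', add_comm]⟩
  have ha' : P.mkQ 1 = P.mkQ a' := (Submodule.Quotient.eq P).mpr ha
  have hb' : P.mkQ b = P.mkQ b' := (Submodule.Quotient.eq P).mpr hb2
  have hd : P.mkQ b' = d' (P.mkQ a') := by
    rw [← sub_eq_zero]; exact hab
  have h1 : d (P.mkQ 1) = d' (P.mkQ 1) := by rw [← hb, hb', hd, ha']
  refine LinearMap.ext fun x ↦ ?_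
  obtain ⟨r, rfl⟩ := P.mkQ_surjective x
  rw [← mul_one r, ← smul_eq_mul, map_smul, map_smul, map_smul, h1]

theorem finite_submodule_of_finite_orbits [Finite (MulAction.orbitRel.Quotient Rˣ M)] :
    Finite (Submodule R M) := by
  refine Finite.of_injective
    (fun N : Submodule R M ↦ {q : MulAction.orbitRel.Quotient Rˣ M | q.out ∈ N}) fun N L h ↦ ?_
  ext x
  obtain ⟨w, hw⟩ : (Quotient.mk (MulAction.orbitRel Rˣ M) x).out ∈ MulAction.orbit Rˣ x :=
    Quotient.mk_out (s := MulAction.orbitRel Rˣ M) x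
  have key (A : Submodule R M) : (Quotient.mk (MulAction.orbitRel Rˣ M) x).out ∈ A ↔ x ∈ A := by
    rw [← hw]
    exact A.smul_mem_iff_of_isUnit w.isUnit
  rw [← key N, ← key L]
  exact Set.ext_iff.mp h _

theorem finite_orbits_of_finite_submodule [IsSemiprimaryRing R] [Finite (Submodule R M)] :
    Finite (MulAction.orbitRel.Quotient Rˣ M) := by
  refine Finite.of_injective
    (fun q : MulAction.orbitRel.Quotient Rˣ M ↦ Submodule.span R {q.out}) fun p q h ↦ ?_
  obtain ⟨w, hw⟩ := (HasStableRangeOne.of_isSemiprimaryRing R).exists_units_smul_eq h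
  rw [← Quotient.out_eq p, ← Quotient.out_eq q]
  exact (Quotient.sound (s := MulAction.orbitRel Rˣ M) ⟨w, hw⟩).symm

theorem inf_sup_of_finite_submodule [IsArtinianRing R] [Finite (Submodule R M)]
    (hM : ∀ N : Submodule R M, N ≠ ⊤ → Infinite (M ⧸ N)) (N L L' : Submodule R M) :
    N ⊓ (L ⊔ L') = (N ⊓ L) ⊔ (N ⊓ L') := by
  refine Submodule.inf_sup_of_forall_exists_smul_mem (R := R) (fun m n ↦ ?_) N L L'
  let A : Ideal R := (Submodule.span R {n}).comap (LinearMap.toSpanSingleton R M m)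
  let B : Ideal R := (Submodule.span R {m}).comap (LinearMap.toSpanSingleton R M n)
  obtain htop | ⟨P, hP, hABP⟩ := eq_top_or_exists_le_coatom (A ⊔ B)
  · obtain ⟨a, ha, b, hb, hab⟩ := Submodule.mem_sup.mp (htop ▸ Submodule.mem_top : (1 : R) ∈ A ⊔ B)
    exact ⟨a, b, hab, ha, hb⟩
  exfalso
  have hAP : A ≤ P := le_sup_left.trans hABP
  have hBP : B ≤ P := le_sup_right.trans hABP
  have : IsSimpleModule R (R ⧸ P) := isSimpleModule_iff_isCoatom.mpr hP
  have : Finite (Module.End R (R ⧸ P)) :=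
    finite_end_quotient_of_finite_submodule P m n (fun a ha ↦ hAP ha) (fun b hb ↦ hBP hb)
  have : Finite (R ⧸ P) := IsSimpleModule.finite_of_finite_end (R := R)
  exact not_ker_toSpanSingleton_le_of_finite_quotient hM P hP.ne_top m
    ((Submodule.comap_mono bot_le).trans hAP)

end Distributive

theorem finite_orbits_tfae_of_no_finite_quotient
    (R : Type u) [Ring R] [IsArtinianRing R]
    (M : Type v) [AddCommGroup M] [Module R M]
    (hM : ∀ N : Submodule R M, N ≠ ⊤ → Infinite (M ⧸ N)) :
    List.TFAE
      [Finite (MulAction.orbitRel.Quotient Rˣ M),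
       Finite (Submodule R M),
       IsArtinian R M ∧ ∀ N L L' : Submodule R M, N ⊓ (L ⊔ L') = (N ⊓ L) ⊔ (N ⊓ L')] := by
  tfae_have 1 → 2 := fun _ ↦ finite_submodule_of_finite_orbits
  tfae_have 2 → 1 := fun _ ↦ finite_orbits_of_finite_submodule
  tfae_have 2 → 3 := fun _ ↦ ⟨inferInstance, inf_sup_of_finite_submodule hM⟩
  tfae_have 3 → 2 := fun ⟨_, h⟩ ↦ by
    have : IsNoetherian R M := IsSemiprimaryRing.isNoetherian_iff_isArtinian.mpr ‹_›
    exact finite_of_inf_sup_distrib h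
  tfae_finish
end

section
/- Let R be a ring with only finitely many left ideals, and let S and T be non-isomorphic simple left R-modules such that S is infinite as a set. Then every extension of T by S splits: for every left R-module V and every submodule N of V such that N is isomorphic to S and V/N is isomorphic to T, there exists a submodule N' of V with N ⊓ N' = ⊥ and N ⊔ N' = ⊤. -/
/-!
STATEMENT 6: Let `R` be a ring with only finitely many left ideals, and let `S`, `T`
be non-isomorphic simple left `R`-modules with `S` infinite as a set. Then every
extension of `T` by `S` splits: for every module `V` and submodule `N ≅ S` with
`V/N ≅ T`, `N` has a complement in `V`.
-/

universe u v w

/-- A simple submodule which is not isomorphic to its simple quotient has a complement as soon as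
it receives a nonzero homomorphism from the whole module. -/
theorem exists_isCompl_of_linearMap_ne_zero {R : Type*} [Ring R] {V : Type*} [AddCommGroup V]
    [Module R V] {N : Submodule R V} [IsSimpleModule R N] (hN : IsCoatom N)
    (hne : IsEmpty ((V ⧸ N) ≃ₗ[R] N)) {g : V →ₗ[R] N} (hg : g ≠ 0) :
    ∃ N' : Submodule R V, IsCompl N N' := by
  have hsurj : Function.Surjective g := g.surjective_of_ne_zero hg
  have hle : ¬ N ≤ LinearMap.ker g := fun h => by
    have hker : N = LinearMap.ker g :=
      (hN.le_iff_eq fun htop => hg (LinearMap.ker_eq_top.mp htop)).mp h |>.symm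
    exact hne.false ((Submodule.quotEquivOfEq _ _ hker).trans (g.quotKerEquivOfSurjective hsurj))
  have hatom : IsAtom N := isSimpleModule_iff_isAtom.mp inferInstance
  have hco : IsCoatom (LinearMap.ker g) := isSimpleModule_iff_isCoatom.mp
    (IsSimpleModule.congr (g.quotKerEquivOfSurjective hsurj))
  exact ⟨LinearMap.ker g, disjoint_iff.mpr ((hatom.le_iff.mp inf_le_left).resolve_right
    fun h => hle (inf_eq_left.mp h)), codisjoint_iff.mpr (hco.2 _ (right_lt_sup.mpr hle))⟩

/-- If `y` generates `V`, then an element of `M` killed by the annihilator of `y` is the image of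
`y` under a homomorphism. -/
theorem exists_linearMap_apply_eq {R V M : Type*} [Ring R] [AddCommGroup V] [Module R V]
    [AddCommGroup M] [Module R M] {y : V} (hy : Submodule.span R {y} = ⊤) (m : M)
    (h : ∀ r : R, r • y = 0 → r • m = 0) : ∃ g : V →ₗ[R] M, g y = m := by
  have hsurj : Function.Surjective (LinearMap.toSpanSingleton R V y) := by
    rw [← LinearMap.range_eq_top, LinearMap.range_toSpanSingleton, hy]
  let e := (LinearMap.toSpanSingleton R V y).quotKerEquivOfSurjective hsurj
  refine ⟨(Submodule.liftQ _ (LinearMap.toSpanSingleton R M m) fun r hr => ?_) ∘ₗ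
    e.symm.toLinearMap, ?_⟩
  · simpa using h r (by simpa using hr)
  · have he : e (Submodule.Quotient.mk 1) = y := by simp [e]
    have he' : e.symm y = Submodule.Quotient.mk 1 := e.symm_apply_eq.mpr he.symm
    simp [he']

/-- In a nonsplit extension of simple modules, every element outside the submodule generates. -/
theorem span_singleton_eq_top_of_not_exists_isCompl {R V : Type*} [Ring R] [AddCommGroup V]
    [Module R V] {N : Submodule R V} (hatom : IsAtom N) (hcoatom : IsCoatom N)
    (hns : ¬ ∃ N' : Submodule R V, IsCompl N N') {y : V} (hy : y ∉ N) :
    Submodule.span R {y} = ⊤ := by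
  have hsup : N ⊔ Submodule.span R {y} = ⊤ :=
    hcoatom.2 _ (left_lt_sup.mpr fun h => hy (h (Submodule.mem_span_singleton_self y)))
  rcases hatom.le_iff.mp (inf_le_left : N ⊓ Submodule.span R {y} ≤ N) with h | h
  · exact (hns ⟨_, disjoint_iff.mpr h, codisjoint_iff.mpr hsup⟩).elim
  · rwa [sup_eq_right.mpr (inf_eq_left.mp h)] at hsup

theorem ext_eq_zero_of_finitely_many_left_ideals
    (R : Type u) [Ring R] (hfin : Finite (Submodule R R))
    (S : Type v) [AddCommGroup S] [Module R S]
    (T : Type v) [AddCommGroup T] [Module R T]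
    (hS : IsSimpleModule R S) (hT : IsSimpleModule R T)
    (hne : IsEmpty (S ≃ₗ[R] T)) (hinf : Infinite S) :
    ∀ (V : Type w) [AddCommGroup V] [Module R V] (N : Submodule R V),
      Nonempty (↥N ≃ₗ[R] S) → Nonempty ((V ⧸ N) ≃ₗ[R] T) →
        ∃ N' : Submodule R V, N ⊓ N' = ⊥ ∧ N ⊔ N' = ⊤ := by
  intro V _ _ N ⟨eS⟩ ⟨eT⟩
  have hNsimple : IsSimpleModule R N := IsSimpleModule.congr eS
  have hatom : IsAtom N := isSimpleModule_iff_isAtom.mp hNsimple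
  have hcoatom : IsCoatom N := isSimpleModule_iff_isCoatom.mp (IsSimpleModule.congr eT)
  have hNinf : Infinite N := Infinite.of_injective _ eS.symm.injective
  suffices h : ∃ N' : Submodule R V, IsCompl N N' from
    h.imp fun _ hN' => ⟨hN'.inf_eq_bot, hN'.sup_eq_top⟩
  by_contra hns
  obtain ⟨x, hx⟩ : ∃ x, x ∉ N := by
    by_contra! h
    exact hcoatom.1 (Submodule.eq_top_iff'.mpr h)
  obtain ⟨n, n', hnn', hann⟩ := Finite.exists_ne_map_eq_of_infinite
    fun n : N => LinearMap.ker (LinearMap.toSpanSingleton R V (x + n))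
  have hspan : Submodule.span R {x + (n : V)} = ⊤ :=
    span_singleton_eq_top_of_not_exists_isCompl hatom hcoatom hns
      fun h => hx ((N.add_mem_iff_left n.2).mp h)
  obtain ⟨g, hg⟩ := exists_linearMap_apply_eq hspan (n' - n) fun r hr => by
    have hr' : r • (x + (n' : V)) = 0 := by
      simpa using SetLike.ext_iff.mp hann r |>.mp (by simpa using hr)
    ext
    have : (n' : V) - n = (x + n') - (x + n) := by abel
    simp only [Submodule.coe_smul, Submodule.coe_sub, Submodule.coe_zero]
    rw [this, smul_sub, hr, hr', sub_zero]
  refine hns (exists_isCompl_of_linearMap_ne_zero hcoatom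
    ⟨fun e => hne.false ((eS.symm.trans e.symm).trans eT)⟩ (g := g) fun h => hnn' ?_)
  rw [h, LinearMap.zero_apply] at hg
  exact (sub_eq_zero.mp hg.symm).symm
end

section
/- Let K be an infinite field and A a finite-dimensional K-algebra admitting a triangular complete system of idempotents e₁,…,eₙ. Then A has only finitely many two-sided ideals if and only if for each i the left A-module A·eᵢ is distributive. -/
/-!
STATEMENT 8: Let `K` be an infinite field and `A` a finite-dimensional `K`-algebra
admitting a triangular complete system of idempotents `e₁, …, eₙ`. Then `A` has only
finitely many two-sided ideals if and only if each left module `A·eᵢ` is distributive.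
-/

universe u v

/-- The Peirce component `e * A * f` has dimension at most one over `K`. -/
def PeirceLine (K : Type u) {A : Type v} [Field K] [Ring A] [Algebra K A] (e f : A) : Prop :=
  ∀ x y : A, e * x * f ≠ 0 → ∃ c : K, e * y * f = c • (e * x * f)

section Peirce

variable {K : Type u} [Field K] {A : Type v} [Ring A] [Algebra K A]

/-- A two-sided ideal is closed under scalar multiplication. -/
theorem TwoSidedIdeal.algebra_smul_mem (I : TwoSidedIdeal A) (c : K) {x : A} (hx : x ∈ I) :
    c • x ∈ I := by
  rw [Algebra.smul_def]
  exact I.mul_mem_left _ _ hx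

/-- If `e * A * e` and `f * A * f` consist of scalars, the ideal generated by `w ∈ e * A * f`
meets `e * A * f` in the line spanned by `w`. -/
theorem exists_smul_of_mem_span_singleton {e f w : A} (hw : e * w * f = w)
    (he : ∀ a : A, ∃ c : K, e * a * e = c • e) (hf : ∀ a : A, ∃ c : K, f * a * f = c • f)
    (hee : IsIdempotentElem e) (hff : IsIdempotentElem f)
    {z : A} (hz : z ∈ TwoSidedIdeal.span {w}) : ∃ c : K, e * z * f = c • w := by
  have hew : e * w = w := by rw [← hw, ← mul_assoc, ← mul_assoc, hee.eq]
  have hwf : w * f = w := by rw [← hw, mul_assoc, hff.eq]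
  have key : ∀ z ∈ TwoSidedIdeal.span {w}, ∀ a b : A, ∃ c : K, e * a * z * b * f = c • w := by
    intro z hz
    induction hz using TwoSidedIdeal.span_induction with
    | mem x hx =>
      rw [Set.mem_singleton_iff] at hx
      subst hx
      intro a b
      obtain ⟨c, hc⟩ := he a
      obtain ⟨d, hd⟩ := hf b
      refine ⟨c * d, ?_⟩
      calc e * a * x * b * f = e * a * (e * x * f) * b * f := by rw [hw]
        _ = (e * a * e) * x * (f * b * f) := by simp only [mul_assoc]
        _ = (c * d) • x := by
          rw [hc, hd, smul_mul_assoc, hew, smul_mul_smul_comm, hwf]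
    | zero => exact fun a b => ⟨0, by simp⟩
    | add x y _ _ hx hy =>
      intro a b
      obtain ⟨c, hc⟩ := hx a b
      obtain ⟨d, hd⟩ := hy a b
      exact ⟨c + d, by rw [mul_add, add_mul, add_mul, hc, hd, add_smul]⟩
    | neg x _ hx =>
      intro a b
      obtain ⟨c, hc⟩ := hx a b
      exact ⟨-c, by rw [mul_neg, neg_mul, neg_mul, hc, neg_smul]⟩
    | left_absorb a x _ hx =>
      intro a' b
      obtain ⟨c, hc⟩ := hx (a' * a) b
      exact ⟨c, by rw [← hc]; simp only [mul_assoc]⟩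
    | right_absorb b x _ hx =>
      intro a b'
      obtain ⟨c, hc⟩ := hx a (b * b')
      exact ⟨c, by rw [← hc]; simp only [mul_assoc]⟩
  simpa using key z hz 1 1

theorem peirceLine_of_finite_twoSidedIdeal [Infinite K] [Finite (TwoSidedIdeal A)] {e f : A}
    (he : ∀ a : A, ∃ c : K, e * a * e = c • e) (hf : ∀ a : A, ∃ c : K, f * a * f = c • f)
    (hee : IsIdempotentElem e) (hff : IsIdempotentElem f) : PeirceLine K e f := by
  intro x y hx
  by_contra! hy
  set p := e * x * f with hp
  set q := e * y * f with hq
  have hpp : e * p * f = p := by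
    rw [hp, ← mul_assoc, ← mul_assoc, hee.eq, mul_assoc, hff.eq]
  have hqq : e * q * f = q := by
    rw [hq, ← mul_assoc, ← mul_assoc, hee.eq, mul_assoc, hff.eq]
  have hw : ∀ c : K, e * (q + c • p) * f = q + c • p := fun c => by
    rw [mul_add, add_mul, hqq, mul_smul_comm, smul_mul_assoc, hpp]
  refine not_injective_infinite_finite
    (fun c : K => TwoSidedIdeal.span {q + c • p}) fun c d hcd => ?_
  have hmem : q + d • p ∈ TwoSidedIdeal.span {q + c • p} := by
    rw [show TwoSidedIdeal.span {q + c • p} = TwoSidedIdeal.span {q + d • p} from hcd]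
    exact TwoSidedIdeal.subset_span rfl
  obtain ⟨k, hk⟩ := exists_smul_of_mem_span_singleton (hw c) he hf hee hff hmem
  rw [hw d] at hk
  have hlin : (1 - k) • q = (k * c - d) • p := by
    rw [sub_smul, sub_smul, one_smul, mul_smul, sub_eq_sub_iff_add_eq_add, hk, smul_add, add_comm]
  by_cases h1 : 1 - k = 0
  · rw [h1, zero_smul, eq_comm, smul_eq_zero_iff_left hx, ← sub_eq_zero.mp h1, one_mul] at hlin
    exact sub_eq_zero.mp hlin
  · exact absurd (by rw [mul_smul, ← hlin, inv_smul_smul₀ h1]) (hy ((1 - k)⁻¹ * (k * c - d)))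

variable {ι : Type*} [Fintype ι] {e : ι → A}

/-- A two-sided ideal contains an element exactly when it contains its Peirce components. -/
theorem TwoSidedIdeal.mem_iff_forall_peirce (hsum : ∑ i, e i = 1) (I : TwoSidedIdeal A) (z : A) :
    z ∈ I ↔ ∀ i j, e i * z * e j ∈ I := by
  refine ⟨fun h i j => I.mul_mem_right _ _ (I.mul_mem_left _ _ h), fun h => ?_⟩
  have hz : z = ∑ i, ∑ j, e i * z * e j := by
    simp_rw [← Finset.mul_sum, hsum, mul_one, ← Finset.sum_mul, hsum, one_mul]
  rw [hz]
  exact sum_mem fun i _ => sum_mem fun j _ => h i j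

theorem finite_twoSidedIdeal_of_peirceLine (hsum : ∑ i, e i = 1)
    (h : ∀ i j, PeirceLine K (e i) (e j)) : Finite (TwoSidedIdeal A) := by
  let S : TwoSidedIdeal A → Set (ι × ι) := fun I => {p | ∀ a, e p.1 * a * e p.2 ∈ I}
  have hS : ∀ (I : TwoSidedIdeal A) z,
      z ∈ I ↔ ∀ i j, e i * z * e j = 0 ∨ (i, j) ∈ S I := by
    intro I z
    rw [I.mem_iff_forall_peirce hsum]
    refine forall₂_congr fun i j => ⟨fun hz => or_iff_not_imp_left.mpr fun h0 a => ?_, ?_⟩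
    · obtain ⟨c, hc⟩ := h i j z a h0
      simpa only [hc] using I.algebra_smul_mem c hz
    · rintro (h0 | hij)
      · exact h0 ▸ I.zero_mem
      · exact hij z
  refine Finite.of_injective S fun I J hIJ => TwoSidedIdeal.ext fun z => ?_
  rw [hS, hS, hIJ]

theorem mul_eq_of_mem_span_singleton {f x : A} (hf : IsIdempotentElem f)
    (hx : x ∈ Submodule.span A {f}) : x * f = x := by
  obtain ⟨a, rfl⟩ := Submodule.mem_span_singleton.mp hx
  rw [smul_eq_mul, mul_assoc, hf.eq]

theorem distrib_of_peirceLine (hsum : ∑ i, e i = 1) {f : A} (hf : IsIdempotentElem f)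
    (h : ∀ i, PeirceLine K (e i) f) (N L L' : Submodule A (Submodule.span A {f})) :
    N ⊓ (L ⊔ L') = (N ⊓ L) ⊔ (N ⊓ L') := by
  refine le_antisymm ?_ le_inf_sup
  rintro z ⟨hzN, hz⟩
  obtain ⟨l, hl, l', hl', rfl⟩ := Submodule.mem_sup.mp hz
  rw [← one_smul A (l + l'), ← hsum, Finset.sum_smul]
  refine sum_mem fun i _ => ?_
  by_cases h0 : e i • l = 0
  · refine Submodule.mem_sup_right ⟨N.smul_mem _ hzN, ?_⟩
    rw [smul_add, h0, zero_add]
    exact L'.smul_mem _ hl'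
  · have hmul : ∀ x : Submodule.span A {f}, e i * (x : A) * f = (e i • x : Submodule.span A {f}) :=
      fun x => by
        rw [mul_assoc, mul_eq_of_mem_span_singleton hf x.2, Submodule.coe_smul, smul_eq_mul]
    obtain ⟨c, hc⟩ := h i l (l + l' : Submodule.span A {f}) fun h => h0 (Subtype.ext (by
      rw [← hmul, h, Submodule.coe_zero]))
    refine Submodule.mem_sup_left ⟨N.smul_mem _ hzN, ?_⟩
    have hcl : e i • (l + l') = algebraMap K A c • e i • l := Subtype.ext (by
      rw [← hmul, hc, hmul, Algebra.smul_def]; rfl)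
    rw [hcl]
    exact L.smul_mem _ (L.smul_mem _ hl)

theorem peirceLine_of_distrib {e f : A} (he : ∀ a : A, ∃ c : K, e * a * e = c • e)
    (hee : IsIdempotentElem e)
    (h : ∀ N L L' : Submodule A (Submodule.span A {f}), N ⊓ (L ⊔ L') = (N ⊓ L) ⊔ (N ⊓ L')) :
    PeirceLine K e f := by
  intro x y hx
  by_contra! hy
  let p : Submodule.span A {f} := ⟨e * x * f, Submodule.mem_span_singleton.mpr ⟨e * x, rfl⟩⟩
  let q : Submodule.span A {f} := ⟨e * y * f, Submodule.mem_span_singleton.mpr ⟨e * y, rfl⟩⟩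
  have hp : e • p = p := Subtype.ext (by
    change e * (e * x * f) = e * x * f
    rw [← mul_assoc, ← mul_assoc, hee.eq])
  have hq : e • q = q := Subtype.ext (by
    change e * (e * y * f) = e * y * f
    rw [← mul_assoc, ← mul_assoc, hee.eq])
  have hline : ∀ w : Submodule.span A {f}, e • w = w → ∀ z ∈ Submodule.span A {w},
      ∃ c : K, e * (z : A) = c • (w : A) := by
    intro w hw z hz
    obtain ⟨a, rfl⟩ := Submodule.mem_span_singleton.mp hz
    have hw' : e * (w : A) = w := congrArg Subtype.val hw
    obtain ⟨c, hc⟩ := he a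
    refine ⟨c, ?_⟩
    rw [Submodule.coe_smul, smul_eq_mul, ← hw', ← mul_assoc, ← mul_assoc, hc, smul_mul_assoc]
  have hpq : e • (p + q) = p + q := by rw [smul_add, hp, hq]
  have hmem : p + q ∈ Submodule.span A {p + q} ⊓ (Submodule.span A {p} ⊔ Submodule.span A {q}) :=
    ⟨Submodule.mem_span_singleton_self _, Submodule.add_mem_sup
      (Submodule.mem_span_singleton_self _) (Submodule.mem_span_singleton_self _)⟩
  rw [h] at hmem
  obtain ⟨a, ⟨haN, haL⟩, b, ⟨hbN, hbL⟩, hab⟩ := Submodule.mem_sup.mp hmem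
  obtain ⟨c₁, h₁⟩ := hline _ hpq a haN
  obtain ⟨c₂, h₂⟩ := hline _ hp a haL
  obtain ⟨d₁, k₁⟩ := hline _ hpq b hbN
  obtain ⟨d₂, k₂⟩ := hline _ hq b hbL
  replace hy : ∀ c : K, (q : A) ≠ c • (p : A) := hy
  replace hx : (p : A) ≠ 0 := hx
  have hsum : (p : A) + q = e * (a : A) + e * (b : A) := by
    rw [← mul_add, ← Submodule.coe_add, ← Submodule.coe_add, hab]
    exact (congrArg Subtype.val hpq).symm
  rw [h₁, Submodule.coe_add] at h₂
  rw [k₁, Submodule.coe_add] at k₂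
  have hc : c₁ = 0 := by
    by_contra hc
    refine hy (c₁⁻¹ * (c₂ - c₁)) ?_
    rw [mul_smul, sub_smul, ← h₂, smul_add, add_sub_cancel_left, inv_smul_smul₀ hc]
  have hd : d₁ = 0 := by
    by_contra hd
    have hk : d₁ • (p : A) = (d₂ - d₁) • (q : A) := by
      rw [sub_smul, ← k₂, smul_add, add_sub_cancel_right]
    by_cases hd' : d₂ - d₁ = 0
    · rw [hd', zero_smul, smul_eq_zero_iff_left hx] at hk
      exact hd hk
    · exact hy ((d₂ - d₁)⁻¹ * d₁) (by rw [mul_smul, hk, inv_smul_smul₀ hd'])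
  rw [h₁, k₁, hc, hd, zero_smul, add_zero] at hsum
  exact hy (-1) (by rw [neg_one_smul]; exact eq_neg_of_add_eq_zero_right hsum)

end Peirce

theorem finite_twoSidedIdeals_iff_projectives_distributive
    (K : Type u) [Field K] [Infinite K]
    (A : Type v) [Ring A] [Algebra K A] [FiniteDimensional K A]
    (n : ℕ) (e : Fin n → A)
    (hne : ∀ i, e i ≠ 0)
    (hidem : ∀ i, IsIdempotentElem (e i))
    (horth : ∀ i j, i ≠ j → e i * e j = 0)
    (hsum : ∑ i, e i = 1)
    (hdiag : ∀ i (a : A), ∃ c : K, e i * a * e i = c • e i)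
    (htri : ∀ i j, j < i → ∀ a : A, e i * a * e j = 0) :
    Finite (TwoSidedIdeal A) ↔
      ∀ i, ∀ N L L' : Submodule A ↥(Submodule.span A {e i}),
        N ⊓ (L ⊔ L') = (N ⊓ L) ⊔ (N ⊓ L') := by
  constructor
  · intro _ j
    exact distrib_of_peirceLine hsum (hidem j) fun i =>
      peirceLine_of_finite_twoSidedIdeal (hdiag i) (hdiag j) (hidem i) (hidem j)
  · exact fun h => finite_twoSidedIdeal_of_peirceLine hsum fun i j =>
      peirceLine_of_distrib (hdiag i) (hidem i) (h j)
end

section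
/- Let K be a field, P a finite partial order and y₀ ∈ P. Let P_{y₀} = {f ∈ I(P,K) : f x y = 0 whenever y ≠ y₀}; this is a left ideal of the incidence algebra I(P,K). The assignment S ↦ span_K{ f_{z y₀} : z ∈ S } is an inclusion-preserving bijection from the set of down-closed subsets S of {z ∈ P : z ≤ y₀} onto the set of I(P,K)-submodules of P_{y₀}, where f_{z y₀} denotes the function equal to 1 at the pair (z, y₀) and 0 elsewhere. In particular, P_{y₀} is a distributive module with finitely many submodules. -/
/-!
STATEMENT 9: Let `K` be a field, `P` a finite partial order and `y₀ ∈ P`.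
The set `P_{y₀} = {f ∈ I(P,K) : f x y = 0 whenever y ≠ y₀}` is a left ideal of the
incidence algebra `I(P,K)`, and `S ↦ span_K {f_{z y₀} : z ∈ S}` is an
inclusion-preserving bijection from the down-closed subsets `S` of `{z : z ≤ y₀}`
onto the submodules of `P_{y₀}`.  In particular `P_{y₀}` is a distributive module
with finitely many submodules.
-/

universe u v

/-- The element `f_{z y}` of the incidence algebra: the function equal to `1` at the
pair `(z, y)` (when `z ≤ y`) and `0` elsewhere. -/
def IncidenceAlgebra.single (K : Type u) [Field K] {P : Type v} [PartialOrder P]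
    [DecidableEq P] [DecidableRel ((· ≤ ·) : P → P → Prop)] (z y : P) : IncidenceAlgebra K P :=
  ⟨fun a b => if a = z ∧ b = y ∧ z ≤ y then 1 else 0,
   fun _a _b hab => if_neg (by rintro ⟨rfl, rfl, h⟩; exact hab h)⟩

namespace IncidenceAlgebra

section Single

variable {K : Type u} [Field K] {P : Type v} [PartialOrder P] [DecidableEq P]
  [DecidableRel ((· ≤ ·) : P → P → Prop)]

lemma single_apply (z y a b : P) :
    single K z y a b = if a = z ∧ b = y ∧ z ≤ y then 1 else 0 := rfl

lemma single_apply_self {z y : P} (h : z ≤ y) : single K z y z y = 1 :=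
  if_pos ⟨rfl, rfl, h⟩

lemma eq_sum_smul_single [Fintype P] {y₀ : P} {f : IncidenceAlgebra K P}
    (hf : ∀ x y, y ≠ y₀ → f x y = 0) : f = ∑ z, f z y₀ • single K z y₀ := by
  have key (s : Finset P) (g : P → IncidenceAlgebra K P) (a b : P) :
      (∑ z ∈ s, g z) a b = ∑ z ∈ s, g z a b := by
    induction s using Finset.induction_on with
    | empty => rfl
    | insert z s hz ih => rw [Finset.sum_insert hz, Finset.sum_insert hz, add_apply, ih]
  ext a b hab
  rw [key]
  by_cases hb : b = y₀
  · subst hb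
    rw [Finset.sum_eq_single a]
    · simp [constSMul_apply, single_apply_self hab]
    · intro z _ hz
      simp [constSMul_apply, single_apply, hz.symm]
    · simp
  · simp [hf a b hb, constSMul_apply, single_apply, hb]

variable [LocallyFiniteOrder P]

lemma smul_single_smul {y₀ : P} {f : IncidenceAlgebra K P}
    (hf : ∀ x y, y ≠ y₀ → f x y = 0) (c : K) {w z : P} (hwz : w ≤ z) :
    (c • single K w z) • f = (c * f z y₀) • single K w y₀ := by
  ext a b hab
  simp only [smul_eq_mul, mul_apply, constSMul_apply, single_apply]
  by_cases hb : b = y₀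
  · subst hb
    by_cases ha : a = w
    · subst ha
      by_cases hzb : z ≤ b
      · rw [Finset.sum_eq_single z]
        · simp [hwz, hab]
        · intro t _ ht
          simp [ht]
        · intro h
          exact absurd (Finset.mem_Icc.2 ⟨hwz, hzb⟩) h
      · rw [apply_eq_zero_of_not_le hzb f, mul_zero, zero_mul]
        refine Finset.sum_eq_zero fun t ht => ?_
        have : t ≠ z := by
          rintro rfl
          exact hzb (Finset.mem_Icc.1 ht).2
        simp [this]
    · simp [ha]
  · simp [hb, hf _ b hb]

end Single

lemma isLowerSet_of_forall {P : Type v} [LE P] {S : Set P}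
    (h : ∀ z ∈ S, ∀ w, w ≤ z → w ∈ S) : IsLowerSet S :=
  fun a b hba ha => h a ha b hba

section Column

variable (K : Type u) [Field K] {P : Type v} [PartialOrder P] [DecidableEq P]
  [LocallyFiniteOrder P]

/-- The left ideal of functions supported on the pairs `(x, y₀)` with `x` in the
down-closed set `S`. -/
def column (y₀ : P) (S : Set P) (hS : IsLowerSet S) :
    Submodule (IncidenceAlgebra K P) (IncidenceAlgebra K P) where
  carrier := {f | ∀ x y, ¬ (y = y₀ ∧ x ∈ S) → f x y = 0}
  zero_mem' := fun _ _ _ => rfl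
  add_mem' := fun {f g} hf hg x y h => by rw [add_apply, hf x y h, hg x y h, add_zero]
  smul_mem' := fun g f hf x y h => by
    rw [smul_apply]
    refine Finset.sum_eq_zero fun t ht => ?_
    rw [hf t y fun ⟨hy, ht'⟩ => h ⟨hy, hS (Finset.mem_Icc.1 ht).1 ht'⟩, smul_zero]

variable {K}

lemma mem_column {y₀ : P} {S : Set P} {hS : IsLowerSet S} {f : IncidenceAlgebra K P} :
    f ∈ column K y₀ S hS ↔ ∀ x y, ¬ (y = y₀ ∧ x ∈ S) → f x y = 0 := Iff.rfl

lemma mem_column_univ {y₀ : P} {f : IncidenceAlgebra K P} :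
    f ∈ column K y₀ Set.univ isLowerSet_univ ↔ ∀ x y, y ≠ y₀ → f x y = 0 := by
  simp [mem_column]

lemma column_le_column_univ (y₀ : P) (S : Set P) (hS : IsLowerSet S) :
    column K y₀ S hS ≤ column K y₀ Set.univ isLowerSet_univ :=
  fun _ hf => mem_column_univ.2 fun x y hy => hf x y fun h => hy h.1

variable [DecidableRel ((· ≤ ·) : P → P → Prop)]

lemma single_mem_column_iff {y₀ z : P} (hz : z ≤ y₀) {S : Set P} (hS : IsLowerSet S) :
    single K z y₀ ∈ column K y₀ S hS ↔ z ∈ S := by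
  refine ⟨fun h => ?_, fun h x y hxy => if_neg ?_⟩
  swap
  · rintro ⟨rfl, rfl, -⟩
    exact hxy ⟨rfl, h⟩
  by_contra hzS
  have := h z y₀ fun H => hzS H.2
  rw [single_apply_self hz] at this
  exact one_ne_zero this

lemma coe_column_eq_span [Fintype P] {y₀ : P} {S : Set P} (hS : IsLowerSet S)
    (hSy : ∀ z ∈ S, z ≤ y₀) :
    (column K y₀ S hS : Set (IncidenceAlgebra K P)) =
      Submodule.span K {f : IncidenceAlgebra K P | ∃ z ∈ S, f = single K z y₀} := by
  ext f
  refine ⟨fun hf => ?_, fun hf => ?_⟩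
  · rw [eq_sum_smul_single (mem_column_univ.1 (column_le_column_univ y₀ S hS hf))]
    refine Submodule.sum_mem _ fun z _ => ?_
    by_cases hz : z ∈ S
    · exact Submodule.smul_mem _ _ (Submodule.subset_span ⟨z, hz, rfl⟩)
    · rw [hf z y₀ fun h => hz h.2, zero_smul]
      exact Submodule.zero_mem _
  · refine Submodule.span_induction (p := fun g _ => g ∈ column K y₀ S hS) ?_ ?_ ?_ ?_ hf
    · rintro _ ⟨z, hz, rfl⟩
      exact (single_mem_column_iff (hSy z hz) hS).2 hz
    · exact Submodule.zero_mem _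
    · exact fun _ _ _ _ hg hh => Submodule.add_mem _ hg hh
    · intro c g _ hg x y h
      rw [constSMul_apply, hg x y h, smul_zero]

variable {y₀ : P} {N : Submodule (IncidenceAlgebra K P) (IncidenceAlgebra K P)}

lemma single_mem_of_apply_ne_zero {f : IncidenceAlgebra K P} (hfN : f ∈ N)
    (hf : ∀ x y, y ≠ y₀ → f x y = 0) {w z : P} (hwz : w ≤ z) (hz : f z y₀ ≠ 0) :
    single K w y₀ ∈ N := by
  have := N.smul_mem ((f z y₀)⁻¹ • single K w z) hfN
  rwa [smul_single_smul hf _ hwz, inv_mul_cancel₀ hz, one_smul] at this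

lemma single_mem_of_le {w z : P} (hwz : w ≤ z) (hz : z ≤ y₀) (h : single K z y₀ ∈ N) :
    single K w y₀ ∈ N :=
  single_mem_of_apply_ne_zero h (fun _ _ hy => if_neg fun H => hy H.2.1) hwz
    (by rw [single_apply_self hz]; exact one_ne_zero)

lemma mem_iff_forall_single_mem [Fintype P] {f : IncidenceAlgebra K P}
    (hf : ∀ x y, y ≠ y₀ → f x y = 0) :
    f ∈ N ↔ ∀ z, f z y₀ ≠ 0 → single K z y₀ ∈ N := by
  refine ⟨fun h z hz => single_mem_of_apply_ne_zero h hf le_rfl hz, fun h => ?_⟩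
  rw [eq_sum_smul_single hf]
  refine Submodule.sum_mem _ fun z _ => ?_
  by_cases hz : f z y₀ = 0
  · rw [hz, zero_smul]
    exact N.zero_mem
  · have hzy := le_of_ne_zero hz
    have := N.smul_mem (f z y₀ • single K z z) (h z hz)
    rwa [smul_single_smul (fun _ _ hy => if_neg fun H => hy H.2.1) _ le_rfl,
      single_apply_self hzy, mul_one] at this

lemma inf_sup_le_of_le_column [Fintype P]
    {N L L' : Submodule (IncidenceAlgebra K P) (IncidenceAlgebra K P)}
    (hL : L ≤ column K y₀ Set.univ isLowerSet_univ)
    (hL' : L' ≤ column K y₀ Set.univ isLowerSet_univ) :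
    N ⊓ (L ⊔ L') ≤ (N ⊓ L) ⊔ (N ⊓ L') := by
  rintro f ⟨hfN, hfL⟩
  have hf := mem_column_univ.1 (sup_le hL hL' hfL)
  refine (mem_iff_forall_single_mem hf).2 fun z hz => ?_
  have hzN := (mem_iff_forall_single_mem hf).1 hfN z hz
  obtain ⟨g, hg, h, hh, rfl⟩ := Submodule.mem_sup.1 hfL
  by_cases hgz : g z y₀ = 0
  · have hhz : h z y₀ ≠ 0 := by rwa [add_apply, hgz, zero_add] at hz
    exact Submodule.mem_sup_right
      ⟨hzN, single_mem_of_apply_ne_zero hh (mem_column_univ.1 (hL' hh)) le_rfl hhz⟩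
  · exact Submodule.mem_sup_left
      ⟨hzN, single_mem_of_apply_ne_zero hg (mem_column_univ.1 (hL hg)) le_rfl hgz⟩

variable (K) in
/-- Down-closed subsets of `{z | z ≤ y₀}` correspond to submodules of the column at `y₀`. -/
def columnOrderIso [Fintype P] (y₀ : P) :
    {S : Set P // (∀ z ∈ S, z ≤ y₀) ∧ ∀ z ∈ S, ∀ w, w ≤ z → w ∈ S} ≃o
      {N : Submodule (IncidenceAlgebra K P) (IncidenceAlgebra K P) //
        N ≤ column K y₀ Set.univ isLowerSet_univ} where
  toFun S := ⟨column K y₀ S.1 (isLowerSet_of_forall S.2.2), column_le_column_univ _ _ _⟩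
  invFun N := ⟨{z | z ≤ y₀ ∧ single K z y₀ ∈ N.1}, fun _ hz => hz.1,
    fun _ hz _ hw => ⟨hw.trans hz.1, single_mem_of_le hw hz.1 hz.2⟩⟩
  left_inv S := by
    ext z
    exact ⟨fun h => (single_mem_column_iff h.1 (isLowerSet_of_forall S.2.2)).1 h.2,
      fun h => ⟨S.2.1 z h,
        (single_mem_column_iff (S.2.1 z h) (isLowerSet_of_forall S.2.2)).2 h⟩⟩
  right_inv N := by
    ext f
    refine ⟨fun h => ?_, fun h x y hxy => ?_⟩
    · refine (mem_iff_forall_single_mem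
        fun x y hy => h x y fun H => hy H.1).2 fun z hz => ?_
      by_contra hzN
      exact hz (h z y₀ fun H => hzN H.2.2)
    · have hf := mem_column_univ.1 (N.2 h)
      by_contra hne
      obtain rfl : y = y₀ := not_imp_comm.1 (hf x y) hne
      exact hxy ⟨rfl, le_of_ne_zero hne, (mem_iff_forall_single_mem hf).1 h x hne⟩
  map_rel_iff' {S T} := by
    refine ⟨fun h z hz => ?_, fun h f hf x y hxy => hf x y fun H => hxy ⟨H.1, h H.2⟩⟩
    have hzy := S.2.1 z hz
    exact (single_mem_column_iff hzy (isLowerSet_of_forall T.2.2)).1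
      (h ((single_mem_column_iff hzy (isLowerSet_of_forall S.2.2)).2 hz))

end Column

end IncidenceAlgebra

theorem incidenceAlgebra_submodules_of_projective
    (K : Type u) [Field K] (P : Type v) [PartialOrder P] [Fintype P]
    [DecidableEq P] [DecidableRel ((· ≤ ·) : P → P → Prop)] [LocallyFiniteOrder P] (y₀ : P) :
    ∃ Py : Submodule (IncidenceAlgebra K P) (IncidenceAlgebra K P),
      (∀ f : IncidenceAlgebra K P, f ∈ Py ↔ ∀ x y : P, y ≠ y₀ → f x y = 0) ∧
      (∃ e : {S : Set P // (∀ z ∈ S, z ≤ y₀) ∧ ∀ z ∈ S, ∀ w, w ≤ z → w ∈ S} ≃o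
             {N : Submodule (IncidenceAlgebra K P) (IncidenceAlgebra K P) // N ≤ Py},
        ∀ S, ((e S : Submodule (IncidenceAlgebra K P) (IncidenceAlgebra K P)) :
                Set (IncidenceAlgebra K P)) =
              (Submodule.span K
                {f : IncidenceAlgebra K P |
                  ∃ z ∈ (S : Set P), f = IncidenceAlgebra.single K z y₀} :
                Set (IncidenceAlgebra K P))) ∧
      (∀ N L L' : Submodule (IncidenceAlgebra K P) ↥Py,
        N ⊓ (L ⊔ L') = (N ⊓ L) ⊔ (N ⊓ L')) ∧
      Finite (Submodule (IncidenceAlgebra K P) ↥Py) := by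
  refine ⟨IncidenceAlgebra.column K y₀ Set.univ isLowerSet_univ,
    fun f => IncidenceAlgebra.mem_column_univ,
    ⟨IncidenceAlgebra.columnOrderIso K y₀,
      fun S => IncidenceAlgebra.coe_column_eq_span
        (IncidenceAlgebra.isLowerSet_of_forall S.2.2) S.2.1⟩, fun N L L' => ?_, ?_⟩
  · refine le_antisymm ?_ le_inf_sup
    rw [← Submodule.map_le_map_iff_of_injective (Submodule.injective_subtype _),
      Submodule.map_inf _ (Submodule.injective_subtype _), Submodule.map_sup,
      Submodule.map_sup, Submodule.map_inf _ (Submodule.injective_subtype _),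
      Submodule.map_inf _ (Submodule.injective_subtype _)]
    exact IncidenceAlgebra.inf_sup_le_of_le_column (Submodule.map_subtype_le _ _)
      (Submodule.map_subtype_le _ _)
  · exact Finite.of_equiv _ ((IncidenceAlgebra.columnOrderIso K y₀).trans
      (Submodule.mapIic _).symm).toEquiv
end

section
/- Let K be a field and P a finite partial order. An element f of the incidence algebra I(P,K) lies in the Jacobson radical of I(P,K) (the intersection of all maximal left ideals) if and only if f x x = 0 for every x ∈ P. -/
/-!
STATEMENT 10: For a field `K` and a finite partial order `P`, an element `f` of the
incidence algebra `I(P,K)` lies in the Jacobson radical (the intersection of all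
maximal left ideals, i.e. `Ideal.jacobson ⊥`) if and only if `f x x = 0` for all `x`.
-/

universe u v

namespace IncidenceAlgebra

variable {R : Type u} {P : Type v} [PartialOrder P] [LocallyFiniteOrder P]

lemma mul_apply_self [NonUnitalNonAssocSemiring R] (f g : IncidenceAlgebra R P) (x : P) :
    (f * g) x x = f x x * g x x := by
  simp

lemma lt_card_Icc_of_pow_apply_ne_zero [Semiring R] [DecidableEq P] {g : IncidenceAlgebra R P}
    (hg : ∀ x, g x x = 0) (n : ℕ) {a b : P} (h : (g ^ n) a b ≠ 0) :
    n < (Finset.Icc a b).card := by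
  induction n generalizing b with
  | zero => exact Finset.card_pos.2 (Finset.nonempty_Icc.2 (le_of_ne_zero h))
  | succ n ih =>
    rw [pow_succ, mul_apply] at h
    obtain ⟨x, hx, hne⟩ := Finset.exists_ne_zero_of_sum_ne_zero h
    obtain ⟨hax, hxb⟩ := Finset.mem_Icc.1 hx
    have hxb' : x < b := lt_of_le_of_ne hxb fun e => right_ne_zero_of_mul hne (e ▸ hg x)
    have hlt : (Finset.Icc a x).card < (Finset.Icc a b).card :=
      Finset.card_lt_card (Finset.Icc_ssubset_Icc_right (hax.trans hxb) le_rfl hxb')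
    exact (Nat.succ_le_of_lt (ih (left_ne_zero_of_mul hne))).trans_lt hlt

lemma isNilpotent_of_apply_self_eq_zero [Semiring R] [Fintype P] [DecidableEq P]
    {g : IncidenceAlgebra R P} (hg : ∀ x, g x x = 0) : IsNilpotent g := by
  refine ⟨Fintype.card P, ?_⟩
  ext a b _
  by_contra h
  exact (lt_card_Icc_of_pow_apply_ne_zero hg _ h).not_ge (Finset.card_le_univ _)

end IncidenceAlgebra

theorem mem_jacobson_incidenceAlgebra_iff
    (K : Type u) [Field K] (P : Type v) [PartialOrder P] [Fintype P]
    [DecidableEq P] [LocallyFiniteOrder P]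
    (f : IncidenceAlgebra K P) :
    f ∈ Ideal.jacobson (⊥ : Ideal (IncidenceAlgebra K P)) ↔ ∀ x : P, f x x = 0 := by
  rw [Ideal.mem_jacobson_iff]
  constructor
  · intro h x
    by_contra hx
    obtain ⟨z, hz⟩ := h (-((f x x)⁻¹ • 1))
    have hz' := congrArg (fun g : IncidenceAlgebra K P => g x x) (Ideal.mem_bot.1 hz)
    simp [IncidenceAlgebra.sub_apply, IncidenceAlgebra.add_apply, IncidenceAlgebra.neg_apply,
      IncidenceAlgebra.constSMul_apply, -IncidenceAlgebra.mul_apply,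
      IncidenceAlgebra.mul_apply_self] at hz'
    field_simp at hz'
    simp at hz'
  · intro h y
    have hnil : IsNilpotent (y * f) :=
      IncidenceAlgebra.isNilpotent_of_apply_self_eq_zero fun x => by
        rw [IncidenceAlgebra.mul_apply_self, h x, mul_zero]
    obtain ⟨z, hz⟩ := hnil.isUnit_add_one.exists_left_inv
    refine ⟨z, Ideal.mem_bot.2 ?_⟩
    rw [mul_assoc, ← mul_add_one, hz, sub_self]
end

section
/- Let K be a field and A a finite-dimensional K-algebra such that every A-module endomorphism of every finitely generated indecomposable projective A-module is given by multiplication by a scalar from K. Then a finite-dimensional A-module M is distributive if and only if M is thin. -/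
/-!
STATEMENT 11: Let `K` be a field and `A` a finite-dimensional `K`-algebra such that
every `A`-endomorphism of every finitely generated indecomposable projective
`A`-module is multiplication by a scalar from `K`.  Then a finite-dimensional
`A`-module `M` is distributive if and only if it is thin.
-/

universe u v

/-- A module is thin (squarefree) if it has finite length and no chain
`N₀ ≤ N₁ ≤ N₂ ≤ N₃` of submodules has `N₁/N₀` and `N₃/N₂` simple and isomorphic. -/
def IsThinModule (R : Type u) [Ring R] (M : Type v) [AddCommGroup M] [Module R M] : Prop :=
  IsFiniteLength R M ∧
    ∀ N₀ N₁ N₂ N₃ : Submodule R M, N₀ ≤ N₁ → N₁ ≤ N₂ → N₂ ≤ N₃ →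
      IsSimpleModule R (↥N₁ ⧸ Submodule.comap N₁.subtype N₀) →
      IsSimpleModule R (↥N₃ ⧸ Submodule.comap N₃.subtype N₂) →
      IsEmpty ((↥N₁ ⧸ Submodule.comap N₁.subtype N₀) ≃ₗ[R]
        (↥N₃ ⧸ Submodule.comap N₃.subtype N₂))

/-- A module is indecomposable if it is nonzero and is not the internal direct sum of
two nonzero submodules. -/
def IsIndecomposableModule (R : Type u) [Ring R] (M : Type v) [AddCommGroup M]
    [Module R M] : Prop :=
  Nontrivial M ∧ ∀ N N' : Submodule R M, IsCompl N N' → N = ⊥ ∨ N' = ⊥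

/-- An idempotent `e` whose corner ring `e A e` consists of the `K`-multiples of `e`. -/
def HasScalarCorner (K : Type u) [Field K] {A : Type v} [Ring A] [Algebra K A] (e : A) : Prop :=
  IsIdempotentElem e ∧ ∀ a : A, ∃ c : K, e * a * e = c • e

/-- The `e`-component of `M` is at most one-dimensional over `K` for every idempotent `e` with
scalar corner. -/
def HasThinCorners (K : Type u) [Field K] (A : Type v) [Ring A] [Algebra K A]
    (M : Type v) [AddCommGroup M] [Module K M] [Module A M] : Prop :=
  ∀ e : A, HasScalarCorner K e → ∀ x y : M, e • x = 0 ∨ ∃ c : K, e • y = c • e • x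

section Idempotents

variable {A : Type v} [Ring A]

theorem mul_eq_of_mem_span_singleton_s11 {e z : A} (he : IsIdempotentElem e)
    (hz : z ∈ Submodule.span A {e}) : z * e = z := by
  obtain ⟨a, rfl⟩ := Submodule.mem_span_singleton.1 hz
  rw [smul_eq_mul, mul_assoc, he.eq]

theorem projective_span_idempotent {e : A} (he : IsIdempotentElem e) :
    Module.Projective A (Submodule.span A {e}) := by
  refine Module.Projective.of_split (M := A) (Submodule.subtype _)
    (LinearMap.toSpanSingleton A _ ⟨e, Submodule.mem_span_singleton_self e⟩) ?_
  ext z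
  simp [mul_eq_of_mem_span_singleton_s11 he z.2]

theorem isIdempotentElem_of_add {e f g : A} {N N' : Submodule A A} (he : IsIdempotentElem e)
    (hN : N ≤ Submodule.span A {e}) (hd : Disjoint N N') (hf : f ∈ N) (hg : g ∈ N')
    (hfg : f + g = e) : IsIdempotentElem f := by
  have hfe : f * f + f * g = f := by
    rw [← mul_add, hfg, mul_eq_of_mem_span_singleton_s11 he (hN hf)]
  have h1 : f * g ∈ N := by
    rw [eq_sub_of_add_eq' hfe]
    exact N.sub_mem hf (N.smul_mem f hf)
  have h0 : f * g = 0 := Submodule.disjoint_def.1 hd _ h1 (N'.smul_mem f hg)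
  rwa [h0, add_zero] at hfe

variable {K : Type u} [Field K] [Algebra K A]

theorem hasScalarCorner_of_end {e : A} (he : IsIdempotentElem e)
    (h : ∀ φ : Submodule.span A {e} →ₗ[A] Submodule.span A {e},
      ∃ c : K, ∀ x, φ x = algebraMap K A c • x) : HasScalarCorner K e := by
  refine ⟨he, fun a => ?_⟩
  obtain ⟨c, hc⟩ := h ((LinearMap.toSpanSingleton A (Submodule.span A {e})
    ⟨e * a * e, Submodule.mem_span_singleton.2 ⟨e * a, rfl⟩⟩).comp (Submodule.subtype _))
  refine ⟨c, ?_⟩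
  have := congrArg Subtype.val (hc ⟨e, Submodule.mem_span_singleton_self e⟩)
  simpa [← mul_assoc, he.eq, Algebra.smul_def] using this

theorem idempotent_mem_closure_hasScalarCorner [IsArtinian A A]
    (hSchur : ∀ (P : Type v) [AddCommGroup P] [Module A P],
      Module.Finite A P → IsIndecomposableModule A P → Module.Projective A P →
      ∀ φ : P →ₗ[A] P, ∃ c : K, ∀ x : P, φ x = algebraMap K A c • x)
    (e : A) (he : IsIdempotentElem e) :
    e ∈ AddSubmonoid.closure {f : A | HasScalarCorner K f} := by
  induction hS : Submodule.span A {e} using WellFoundedLT.induction generalizing e with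
  | ind S ih =>
    subst hS
    by_cases h0 : e = 0
    · exact h0 ▸ zero_mem _
    by_cases hind : IsIndecomposableModule A (Submodule.span A {e})
    · exact AddSubmonoid.subset_closure (hasScalarCorner_of_end he
        (hSchur _ inferInstance hind (projective_span_idempotent he)))
    have hnt : Nontrivial (Submodule.span A {e}) :=
      ⟨⟨⟨e, Submodule.mem_span_singleton_self e⟩, 0, fun h => h0 (congrArg Subtype.val h)⟩⟩
    obtain ⟨N, N', hc, hN, hN'⟩ : ∃ N N' : Submodule A (Submodule.span A {e}),
        IsCompl N N' ∧ N ≠ ⊥ ∧ N' ≠ ⊥ := by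
      by_contra! h
      exact hind ⟨hnt, fun N N' hc => or_iff_not_imp_left.2 (h N N' hc)⟩
    obtain ⟨f, hf, g, hg, hfg⟩ := Submodule.mem_sup.1
      (hc.sup_eq_top ▸ Submodule.mem_top :
        (⟨e, Submodule.mem_span_singleton_self e⟩ : Submodule.span A {e}) ∈ N ⊔ N')
    have summand_mem : ∀ {N N' : Submodule A (Submodule.span A {e})}
        {f g : Submodule.span A {e}}, IsCompl N N' → N' ≠ ⊥ → f ∈ N → g ∈ N' →
        (f : A) + g = e → (f : A) ∈ AddSubmonoid.closure {f : A | HasScalarCorner K f} := by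
      intro N N' f g hc hN' hf hg hfg
      have hd : Disjoint (N.map (Submodule.subtype _)) (N'.map (Submodule.subtype _)) :=
        Submodule.disjoint_map (Submodule.injective_subtype _) hc.disjoint
      refine ih _ (lt_of_le_of_ne ?_ ?_) f (isIdempotentElem_of_add he
        (Submodule.map_subtype_le _ _) hd (Submodule.mem_map_of_mem hf)
        (Submodule.mem_map_of_mem hg) hfg) rfl
      · exact (Submodule.span_singleton_le_iff_mem _ _).2 f.2
      · intro heq
        have hle : Submodule.span A {e} ≤ N.map (Submodule.subtype _) := by
          exact heq.ge.trans ((Submodule.span_singleton_le_iff_mem _ _).2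
            (Submodule.mem_map_of_mem hf))
        refine hN' (Submodule.map_injective_of_injective (Submodule.injective_subtype _) ?_)
        rw [Submodule.map_bot]
        exact hd.eq_bot_of_ge ((Submodule.map_subtype_le _ _).trans hle)
    have hfg' : (f : A) + g = e := congrArg Subtype.val hfg
    rw [← hfg']
    exact add_mem (summand_mem hc hN' hf hg hfg')
      (summand_mem hc.symm hN hg hf (by rwa [add_comm]))

end Idempotents

section Modules

variable {K : Type u} [Field K] {A : Type v} [Ring A] [Algebra K A]

theorem mem_of_forall_smul_mem {M : Type*} [AddCommGroup M] [Module A M] {s : Set A}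
    (hs : (1 : A) ∈ AddSubmonoid.closure s) (N : Submodule A M) {x : M}
    (h : ∀ e ∈ s, e • x ∈ N) : x ∈ N := by
  have key : ∀ a ∈ AddSubmonoid.closure s, a • x ∈ N := fun a ha => by
    induction ha using AddSubmonoid.closure_induction with
    | mem a ha => exact h a ha
    | zero => simp
    | add a b _ _ iha ihb => exact add_smul a b x ▸ N.add_mem iha ihb
  simpa using key 1 hs

theorem HasScalarCorner.exists_smul_eq {M : Type*} [AddCommGroup M] [Module K M] [Module A M]
    [IsScalarTower K A M] {e : A} (he : HasScalarCorner K e) {x z : M} (hx : e • x = x)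
    (hz : z ∈ Submodule.span A {x}) : ∃ c : K, e • z = c • x := by
  obtain ⟨a, rfl⟩ := Submodule.mem_span_singleton.1 hz
  obtain ⟨c, hc⟩ := he.2 a
  refine ⟨c, ?_⟩
  rw [← hx, ← smul_assoc c, ← hc]
  simp only [mul_smul, hx]

theorem ker_toSpanSingleton_le_of_hasScalarCorner {S T : Type*} [AddCommGroup S] [Module A S]
    [AddCommGroup T] [Module A T] [IsSimpleModule A T]
    {e : A} (he : HasScalarCorner K e) {s : S} {t : T} (hs : e • s = s) (ht : e • t = t)
    (hs0 : s ≠ 0) :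
    LinearMap.ker (LinearMap.toSpanSingleton A S s) ≤
      LinearMap.ker (LinearMap.toSpanSingleton A T t) := by
  intro a ha
  rw [LinearMap.mem_ker, LinearMap.toSpanSingleton_apply] at ha ⊢
  by_contra hat
  obtain ⟨b, hb⟩ := IsSimpleModule.toSpanSingleton_surjective A hat t
  rw [LinearMap.toSpanSingleton_apply] at hb
  obtain ⟨c, hc⟩ := he.2 (b * a)
  have hct : algebraMap K A c • t = t := by
    have := congrArg (· • t) hc
    simpa only [mul_smul, ht, hb, Algebra.smul_def] using this.symm
  have hcs : algebraMap K A c • s = 0 := by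
    have := congrArg (· • s) hc
    simpa only [mul_smul, hs, ha, smul_zero, Algebra.smul_def] using this.symm
  have hc0 : c ≠ 0 := by
    rintro rfl
    rw [map_zero, zero_smul] at hct
    exact hat (by rw [← hct, smul_zero])
  apply hs0
  rw [← one_smul A s, ← map_one (algebraMap K A), ← inv_mul_cancel₀ hc0, map_mul, mul_smul, hcs,
    smul_zero]

theorem nonempty_linearEquiv_of_hasScalarCorner {S T : Type*} [AddCommGroup S] [Module A S]
    [AddCommGroup T] [Module A T] [IsSimpleModule A S] [IsSimpleModule A T]
    {e : A} (he : HasScalarCorner K e) {s : S} {t : T} (hs : e • s = s) (ht : e • t = t)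
    (hs0 : s ≠ 0) (ht0 : t ≠ 0) : Nonempty (S ≃ₗ[A] T) :=
  ⟨(LinearMap.quotKerEquivOfSurjective _
      (IsSimpleModule.toSpanSingleton_surjective A hs0)).symm ≪≫ₗ
    Submodule.quotEquivOfEq _ _ (le_antisymm
      (ker_toSpanSingleton_le_of_hasScalarCorner he hs ht hs0)
      (ker_toSpanSingleton_le_of_hasScalarCorner he ht hs ht0)) ≪≫ₗ
    LinearMap.quotKerEquivOfSurjective _ (IsSimpleModule.toSpanSingleton_surjective A ht0)⟩

variable {M : Type v} [AddCommGroup M] [Module K M] [Module A M] [IsScalarTower K A M]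

theorem HasThinCorners.distributive
    (h1 : (1 : A) ∈ AddSubmonoid.closure {e : A | HasScalarCorner K e})
    (h : HasThinCorners K A M) (N L L' : Submodule A M) :
    N ⊓ (L ⊔ L') = (N ⊓ L) ⊔ (N ⊓ L') := by
  refine le_antisymm (fun n hn => mem_of_forall_smul_mem h1 _ fun e he => ?_) le_inf_sup
  obtain ⟨hnN, hn'⟩ := hn
  obtain ⟨l, hl, l', hl', rfl⟩ := Submodule.mem_sup.1 hn'
  have hN := N.smul_mem e hnN
  rcases h e he l (l + l') with h0 | ⟨c, hc⟩
  · refine Submodule.mem_sup_right ⟨hN, ?_⟩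
    rw [smul_add, h0, zero_add]
    exact L'.smul_mem e hl'
  · refine Submodule.mem_sup_left ⟨hN, ?_⟩
    rw [hc]
    exact L.smul_of_tower_mem c (L.smul_mem e hl)

theorem hasThinCorners_of_distributive
    (h : ∀ N L L' : Submodule A M, N ⊓ (L ⊔ L') = (N ⊓ L) ⊔ (N ⊓ L')) :
    HasThinCorners K A M := by
  intro e he x₀ y₀
  have hx : e • e • x₀ = e • x₀ := by rw [← mul_smul, he.1.eq]
  have hy : e • e • y₀ = e • y₀ := by rw [← mul_smul, he.1.eq]
  generalize e • x₀ = x at hx ⊢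
  generalize e • y₀ = y at hy ⊢
  have hxy : e • (x + y) = x + y := by rw [smul_add, hx, hy]
  by_contra! hcon
  obtain ⟨hx0, hind⟩ := hcon
  have hmem : x + y ∈ Submodule.span A {x + y} ⊓ (Submodule.span A {x} ⊔ Submodule.span A {y}) :=
    ⟨Submodule.mem_span_singleton_self _, Submodule.add_mem_sup
      (Submodule.mem_span_singleton_self _) (Submodule.mem_span_singleton_self _)⟩
  rw [h] at hmem
  obtain ⟨u, ⟨hu, hu'⟩, v, ⟨hv, hv'⟩, huv⟩ := Submodule.mem_sup.1 hmem
  have indep : ∀ a b : K, a • x + b • y = 0 → a = 0 ∧ b = 0 := by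
    intro a b hab
    have hb : b = 0 := by
      by_contra hb
      refine hind (-(b⁻¹ * a)) ?_
      rw [neg_smul, mul_smul, eq_neg_of_add_eq_zero_left hab, smul_neg, neg_neg,
        inv_smul_smul₀ hb]
    subst hb
    rw [zero_smul, add_zero] at hab
    exact ⟨(smul_eq_zero.1 hab).resolve_right hx0, rfl⟩
  obtain ⟨a, ha⟩ := he.exists_smul_eq hxy hu
  obtain ⟨b, hb⟩ := he.exists_smul_eq hx hu'
  obtain ⟨c, hc⟩ := he.exists_smul_eq hxy hv
  obtain ⟨d, hd⟩ := he.exists_smul_eq hy hv'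
  have ha0 : a = 0 := (indep (a - b) a (by
    linear_combination (norm := module) ha.symm.trans hb)).2
  have hc0 : c = 0 := (indep c (c - d) (by
    linear_combination (norm := module) hc.symm.trans hd)).1
  have hsum : x + y = 0 := by
    rw [← hxy, ← huv, smul_add, ha, hc, ha0, hc0, zero_smul, add_zero]
  exact one_ne_zero (indep 1 1 (by simpa using hsum)).1

theorem HasThinCorners.isThinModule [Module.Finite K M]
    (h1 : (1 : A) ∈ AddSubmonoid.closure {e : A | HasScalarCorner K e})
    (h : HasThinCorners K A M) : IsThinModule A M := by
  refine ⟨isFiniteLength_iff_isNoetherian_isArtinian.2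
    ⟨isNoetherian_of_tower K inferInstance, isArtinian_of_tower K inferInstance⟩, ?_⟩
  intro N₀ N₁ N₂ N₃ _ h12 _ hS _
  refine ⟨fun φ => ?_⟩
  have := hS.nontrivial
  obtain ⟨s, hs0⟩ := exists_ne (0 : ↥N₁ ⧸ Submodule.comap N₁.subtype N₀)
  obtain ⟨e, he, hes⟩ : ∃ e, HasScalarCorner K e ∧ e • s ≠ 0 := by
    by_contra! hcon
    exact hs0 ((Submodule.mem_bot A).1
      (mem_of_forall_smul_mem h1 _ fun e he => (Submodule.mem_bot A).2 (hcon e he)))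
  have het : e • φ s ≠ 0 := by
    rw [← map_smul]
    exact φ.map_ne_zero_iff.2 hes
  obtain ⟨x, rfl⟩ := Submodule.Quotient.mk_surjective _ s
  obtain ⟨y, hy⟩ := Submodule.Quotient.mk_surjective _
    (φ (Submodule.Quotient.mk x))
  rw [← hy, ← Submodule.Quotient.mk_smul, Ne, Submodule.Quotient.mk_eq_zero] at het
  rw [← Submodule.Quotient.mk_smul, Ne, Submodule.Quotient.mk_eq_zero] at hes
  rcases h e he (x : M) (y : M) with h0 | ⟨c, hc⟩
  · exact hes (by simp [h0])
  · refine het (show e • (y : M) ∈ N₂ from hc ▸ N₂.smul_of_tower_mem c (h12 ?_))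
    exact N₁.smul_mem e x.2

theorem IsThinModule.hasThinCorners (h : IsThinModule A M) : HasThinCorners K A M := by
  intro e he x₀ y₀
  have hx : e • e • x₀ = e • x₀ := by rw [← mul_smul, he.1.eq]
  have hy : e • e • y₀ = e • y₀ := by rw [← mul_smul, he.1.eq]
  generalize e • x₀ = x at hx ⊢
  generalize e • y₀ = y at hy ⊢
  by_contra! hcon
  obtain ⟨hx0, hind⟩ := hcon
  obtain ⟨hlen, hthin⟩ := h
  obtain ⟨_, _⟩ := isFiniteLength_iff_isNoetherian_isArtinian.1 hlen
  have hyx : y ∉ Submodule.span A {x} := fun hmem => by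
    obtain ⟨c, hc⟩ := he.exists_smul_eq hx hmem
    exact hind c (hy ▸ hc)
  obtain ⟨N₀, -, h01⟩ := exists_le_covBy_of_lt
    (bot_lt_iff_ne_bot.2 (mt (Submodule.span_singleton_eq_bot (R := A)).1 hx0))
  obtain ⟨N₂, h12, h23⟩ := exists_le_covBy_of_lt
    (left_lt_sup.2 fun hle : Submodule.span A {y} ≤ Submodule.span A {x} =>
      hyx ((Submodule.span_singleton_le_iff_mem _ _).1 hle))
  have hS := (covBy_iff_quot_is_simple h01.le).1 h01
  have hT := (covBy_iff_quot_is_simple h23.le).1 h23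
  have hxN : x ∉ N₀ := fun hmem =>
    h01.lt.not_ge ((Submodule.span_singleton_le_iff_mem _ _).2 hmem)
  have hyN : y ∉ N₂ := fun hmem =>
    h23.lt.not_ge (sup_le h12 ((Submodule.span_singleton_le_iff_mem _ _).2 hmem))
  obtain ⟨φ⟩ := nonempty_linearEquiv_of_hasScalarCorner he
    (s := (Submodule.Quotient.mk ⟨x, Submodule.mem_span_singleton_self x⟩ :
      _ ⧸ Submodule.comap (Submodule.span A {x}).subtype N₀))
    (t := (Submodule.Quotient.mk
        ⟨y, Submodule.mem_sup_right (Submodule.mem_span_singleton_self y)⟩ :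
      _ ⧸ Submodule.comap (Submodule.span A {x} ⊔ Submodule.span A {y}).subtype N₂))
    (by rw [← Submodule.Quotient.mk_smul]; congr 1; exact Subtype.ext hx)
    (by rw [← Submodule.Quotient.mk_smul]; congr 1; exact Subtype.ext hy)
    (by rwa [Ne, Submodule.Quotient.mk_eq_zero])
    (by rwa [Ne, Submodule.Quotient.mk_eq_zero])
  exact (hthin N₀ _ N₂ _ h01.le h12 h23.le hS hT).false φ

end Modules

theorem distributive_iff_thin
    (K : Type u) [Field K] (A : Type v) [Ring A] [Algebra K A] [FiniteDimensional K A]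
    (hSchur : ∀ (P : Type v) [AddCommGroup P] [Module A P],
      Module.Finite A P → IsIndecomposableModule A P → Module.Projective A P →
      ∀ φ : P →ₗ[A] P, ∃ c : K, ∀ x : P, φ x = algebraMap K A c • x)
    (M : Type v) [AddCommGroup M] [Module K M] [Module A M] [IsScalarTower K A M]
    [Module.Finite K M] :
    (∀ N L L' : Submodule A M, N ⊓ (L ⊔ L') = (N ⊓ L) ⊔ (N ⊓ L')) ↔ IsThinModule A M := by
  have : IsArtinian A A := isArtinian_of_tower K inferInstance
  have h1 : (1 : A) ∈ AddSubmonoid.closure {e : A | HasScalarCorner K e} :=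
    idempotent_mem_closure_hasScalarCorner hSchur 1 IsIdempotentElem.one
  exact ⟨fun h => (hasThinCorners_of_distributive (K := K) h).isThinModule h1,
    fun h => (h.hasThinCorners (K := K)).distributive h1⟩
end

section
/- Let K be an infinite field and A a finite-dimensional K-algebra admitting a triangular complete system of idempotents. If A has a faithful finite-dimensional distributive module, then A is isomorphic as a K-algebra to the incidence algebra I(P,K) of some finite partial order P. -/
/-!
STATEMENT 13: Let `K` be an infinite field and `A` a finite-dimensional `K`-algebra
admitting a triangular complete system of idempotents.  If `A` has a faithful
finite-dimensional distributive module, then `A` is isomorphic as a `K`-algebra to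
the incidence algebra `I(P,K)` of some finite partial order `P`.
-/

universe u v w

/-- If the lattice of submodules of `M` is distributive and `e` is an idempotent with
`e A e = K e`, then `e M` is at most one-dimensional. -/
theorem exists_smul_eq_of_distributive
    {K : Type u} [Field K] {A : Type v} [Ring A] [Algebra K A]
    {M : Type w} [AddCommGroup M] [Module K M] [Module A M] [IsScalarTower K A M]
    (hdist : ∀ N L L' : Submodule A M, N ⊓ (L ⊔ L') = (N ⊓ L) ⊔ (N ⊓ L'))
    {e : A} (hdiag : ∀ a : A, ∃ c : K, e * a * e = c • e)
    {x y : M} (hx : e • x = x) (hy : e • y = y) (hx0 : x ≠ 0) :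
    ∃ c : K, y = c • x := by
  have corner : ∀ {z u : M}, e • z = z → u ∈ Submodule.span A {z} → ∃ c : K, e • u = c • z := by
    intro z u hz hu
    obtain ⟨a, rfl⟩ := Submodule.mem_span_singleton.1 hu
    obtain ⟨c, hc⟩ := hdiag a
    refine ⟨c, ?_⟩
    calc e • a • z = (e * a * e) • z := by rw [mul_smul, mul_smul, hz]
      _ = c • z := by rw [hc, smul_assoc, hz]
  have hxy : e • (x + y) = x + y := by rw [smul_add, hx, hy]
  have hmem : x + y ∈ Submodule.span A {x + y} ⊓
      (Submodule.span A {x} ⊔ Submodule.span A {y}) :=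
    ⟨Submodule.mem_span_singleton_self _, Submodule.add_mem_sup
      (Submodule.mem_span_singleton_self _) (Submodule.mem_span_singleton_self _)⟩
  rw [hdist] at hmem
  obtain ⟨u, hu, v, hv, huv⟩ := Submodule.mem_sup.1 hmem
  obtain ⟨c₁, hc₁⟩ := corner hxy hu.1
  obtain ⟨d₁, hd₁⟩ := corner hx hu.2
  obtain ⟨d₂, hd₂⟩ := corner hy hv.2
  have hdep : x + y = d₁ • x + d₂ • y := by rw [← hd₁, ← hd₂, ← smul_add, huv, hxy]
  by_cases h₁ : c₁ = 0
  · have h : x = (d₂ - 1) • y := by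
      have hd₁x : d₁ • x = 0 := by rw [← hd₁, hc₁, h₁, zero_smul]
      rw [hd₁x, zero_add] at hdep
      rw [sub_smul, one_smul, ← hdep, add_sub_cancel_right]
    have hd : d₂ - 1 ≠ 0 := fun h₀ ↦ hx0 (by rw [h, h₀, zero_smul])
    exact ⟨(d₂ - 1)⁻¹, by rw [h, inv_smul_smul₀ hd]⟩
  · have h : c₁ • y = (d₁ - c₁) • x := by
      rw [sub_smul, ← hd₁, hc₁, smul_add, add_sub_cancel_left]
    exact ⟨c₁⁻¹ * (d₁ - c₁), by rw [mul_smul, ← h, inv_smul_smul₀ h₁]⟩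

open Matrix in
/-- An algebra of matrices containing all diagonal matrix units, and whose support is the
relation `≤` of a partial order, is the incidence algebra of that order. -/
theorem nonempty_algEquiv_incidenceAlgebra_of_matrix
    {K : Type u} [Field K] {A : Type v} [Ring A] [Algebra K A]
    {ι : Type*} [PartialOrder ι] [Fintype ι] [DecidableEq ι] [LocallyFiniteOrder ι]
    (Φ : A →ₐ[K] Matrix ι ι K) (hΦ : Function.Injective Φ)
    (e : ι → A) (he : ∀ i, Φ (e i) = single i i 1)
    (hle : ∀ i j, i ≤ j ↔ ∃ a, Φ a i j ≠ 0) :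
    Nonempty (A ≃ₐ[K] IncidenceAlgebra K ι) := by
  have hzero : ∀ a i j, ¬ i ≤ j → Φ a i j = 0 := fun a i j h ↦ by
    by_contra h'
    exact h ((hle i j).2 ⟨a, h'⟩)
  let Ψ : A →ₗ[K] IncidenceAlgebra K ι :=
    { toFun := fun a ↦ ⟨fun i j ↦ Φ a i j, fun i j ↦ hzero a i j⟩
      map_add' := fun a b ↦ by
        ext i j
        exact congr_fun₂ (map_add Φ a b) i j
      map_smul' := fun c a ↦ by
        ext i j
        exact congr_fun₂ (map_smul Φ c a) i j }
  have hΨ : ∀ a i j, Ψ a i j = Φ a i j := fun _ _ _ ↦ rfl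
  have hone : Ψ 1 = 1 := by
    ext i j
    rw [hΨ, map_one, Matrix.one_apply, IncidenceAlgebra.one_apply]
  have hmul : ∀ a b, Ψ (a * b) = Ψ a * Ψ b := by
    intro a b
    ext i j
    rw [hΨ, map_mul, Matrix.mul_apply, IncidenceAlgebra.mul_apply]
    refine (Finset.sum_subset (Finset.subset_univ _) fun k _ hk ↦ ?_).symm
    rw [Finset.mem_Icc, not_and_or] at hk
    rcases hk with hk | hk
    · exact mul_eq_zero_of_left (hzero a i k hk) _
    · exact mul_eq_zero_of_right _ (hzero b k j hk)
  have hunit : ∀ i j, ∃ a : A, i ≤ j → Φ a = single i j 1 := by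
    intro i j
    by_cases hij : i ≤ j
    · obtain ⟨a, ha⟩ := (hle i j).1 hij
      refine ⟨(Φ a i j)⁻¹ • (e i * a * e j), fun _ ↦ ?_⟩
      rw [map_smul, map_mul, map_mul, he, he, single_mul_mul_single, smul_single]
      simp [ha]
    · exact ⟨0, fun h ↦ absurd h hij⟩
  choose E hE using hunit
  refine ⟨AlgEquiv.ofBijective (AlgHom.ofLinearMap Ψ hone hmul) ⟨fun a b hab ↦ hΦ ?_, fun f ↦ ?_⟩⟩
  · ext i j
    exact congr_fun₂ (congr_arg DFunLike.coe hab) i j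
  · refine ⟨∑ i, ∑ j, f i j • E i j, ?_⟩
    ext i j
    change Φ _ i j = f i j
    have : Φ (∑ i, ∑ j, f i j • E i j) = of fun i j ↦ f i j := by
      rw [matrix_eq_sum_single (of fun i j ↦ f i j)]
      simp only [map_sum, map_smul]
      refine Finset.sum_congr rfl fun i _ ↦ Finset.sum_congr rfl fun j _ ↦ ?_
      by_cases hij : i ≤ j
      · rw [hE i j hij, smul_single, smul_eq_mul, mul_one, of_apply]
      · rw [of_apply, IncidenceAlgebra.apply_eq_zero_of_not_le hij, zero_smul, single_zero]
    rw [this, of_apply]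

/-- A faithful distributive module over an algebra with a complete system of orthogonal
idempotents `e i` such that `e i A e i = K e i` has a basis of vectors `b i` fixed by `e i`. -/
theorem exists_basis_of_faithful_distributive
    {K : Type u} [Field K] {A : Type v} [Ring A] [Algebra K A]
    {ι : Type*} [Fintype ι] {e : ι → A} (hne : ∀ i, e i ≠ 0)
    (he : CompleteOrthogonalIdempotents e)
    (hdiag : ∀ i (a : A), ∃ c : K, e i * a * e i = c • e i)
    {M : Type w} [AddCommGroup M] [Module K M] [Module A M] [IsScalarTower K A M]
    [FaithfulSMul A M]
    (hdist : ∀ N L L' : Submodule A M, N ⊓ (L ⊔ L') = (N ⊓ L) ⊔ (N ⊓ L')) :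
    ∃ b : Module.Basis ι K M, ∀ i, e i • b i = b i := by
  have hidem : ∀ i (x : M), e i • e i • x = e i • x := fun i x ↦ by
    rw [← mul_smul, (he.idem i).eq]
  have hex : ∀ i, ∃ x : M, e i • x = x ∧ x ≠ 0 := by
    intro i
    by_contra! h
    refine hne i (FaithfulSMul.eq_of_smul_eq_smul (α := M) fun x ↦ ?_)
    rw [h _ (hidem i x), zero_smul]
  choose m hm hm0 using hex
  have hort : ∀ i j, i ≠ j → e i • m j = 0 := fun i j hij ↦ by
    rw [← hm j, ← mul_smul, he.ortho hij, zero_smul]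
  have hli : LinearIndependent K m := by
    rw [Fintype.linearIndependent_iff]
    intro g hg i
    have h : e i • ∑ j, g j • m j = g i • m i := by
      rw [Finset.smul_sum, Finset.sum_eq_single i]
      · rw [smul_comm, hm]
      · intro j _ hj
        rw [smul_comm, hort i j hj.symm, smul_zero]
      · simp
    rw [hg, smul_zero] at h
    exact (smul_eq_zero.1 h.symm).resolve_right (hm0 i)
  have hspan : ⊤ ≤ Submodule.span K (Set.range m) := by
    intro x _
    rw [← one_smul A x, ← he.complete, Finset.sum_smul]
    refine Submodule.sum_mem _ fun i _ ↦ ?_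
    obtain ⟨c, hc⟩ := exists_smul_eq_of_distributive hdist (hdiag i) (hm i) (hidem i x) (hm0 i)
    rw [hc]
    exact Submodule.smul_mem _ _ (Submodule.subset_span ⟨i, rfl⟩)
  exact ⟨.mk hli hspan, fun i ↦ by rw [Module.Basis.mk_apply, hm]⟩

theorem isIncidenceAlgebra_of_faithful_distributive
    (K : Type u) [Field K] [Infinite K]
    (A : Type v) [Ring A] [Algebra K A] [FiniteDimensional K A]
    (n : ℕ) (e : Fin n → A)
    (hne : ∀ i, e i ≠ 0)
    (hidem : ∀ i, IsIdempotentElem (e i))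
    (horth : ∀ i j, i ≠ j → e i * e j = 0)
    (hsum : ∑ i, e i = 1)
    (hdiag : ∀ i (a : A), ∃ c : K, e i * a * e i = c • e i)
    (htri : ∀ i j, j < i → ∀ a : A, e i * a * e j = 0)
    (M : Type w) [AddCommGroup M] [Module K M] [Module A M] [IsScalarTower K A M]
    [Module.Finite K M]
    (hfaithful : FaithfulSMul A M)
    (hdist : ∀ N L L' : Submodule A M, N ⊓ (L ⊔ L') = (N ⊓ L) ⊔ (N ⊓ L')) :
    ∃ (P : Type) (_ : PartialOrder P) (_ : Fintype P) (_ : DecidableEq P)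
        (_ : LocallyFiniteOrder P), Nonempty (A ≃ₐ[K] IncidenceAlgebra K P) := by
  classical
  have he : CompleteOrthogonalIdempotents e := ⟨⟨hidem, fun i j h ↦ horth i j h⟩, hsum⟩
  obtain ⟨b, hb⟩ := exists_basis_of_faithful_distributive (M := M) hne he hdiag hdist
  let Φ : A →ₐ[K] Matrix (Fin n) (Fin n) K :=
    (LinearMap.toMatrixAlgEquiv b).toAlgHom.comp (Algebra.lsmul K K M)
  have hΦ_apply : ∀ a i j, Φ a i j = b.repr (a • b j) i := fun a i j ↦
    LinearMap.toMatrixAlgEquiv_apply b _ i j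
  have hΦ : Function.Injective Φ := by
    refine (LinearMap.toMatrixAlgEquiv b).injective.comp fun a a' h ↦ ?_
    exact FaithfulSMul.eq_of_smul_eq_smul (α := M) fun x ↦ LinearMap.congr_fun h x
  have heΦ : ∀ i, Φ (e i) = Matrix.single i i 1 := by
    intro i
    ext k j
    rw [hΦ_apply]
    by_cases hij : i = j
    · subst hij
      simp [hb, Finsupp.single_apply, Matrix.single_apply]
    · rw [← hb j, ← mul_smul, horth i j hij]
      simp [hij]
  have hcorner : ∀ i j a, Φ (e i * a * e j) = Matrix.single i j (Φ a i j) := by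
    intro i j a
    simp [heΦ, Matrix.single_mul_mul_single]
  have hsupp : ∀ {i j}, (∃ a, Φ a i j ≠ 0) → i ≤ j := by
    rintro i j ⟨a, ha⟩
    by_contra! hij
    have h := hcorner i j a
    rw [htri i j hij, map_zero] at h
    exact ha (by simpa using (congr_fun₂ h i j).symm)
  let P : PartialOrder (Fin n) :=
    { le := fun i j ↦ ∃ a, Φ a i j ≠ 0
      lt := fun i j ↦ (∃ a, Φ a i j ≠ 0) ∧ ¬ ∃ a, Φ a j i ≠ 0
      lt_iff_le_not_ge := fun _ _ ↦ Iff.rfl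
      le_refl := fun i ↦ ⟨1, by simp⟩
      le_trans := by
        rintro i j k ⟨a, ha⟩ ⟨a', ha'⟩
        refine ⟨a * e j * a', ?_⟩
        have h : Φ (a * e j * a') i k = Φ a i j * Φ a' j k := by
          simp [heΦ, Matrix.mul_apply, Matrix.single_apply, ite_and]
        rw [h]
        exact mul_ne_zero ha ha'
      le_antisymm := fun i j hij hji ↦ le_antisymm (hsupp hij) (hsupp hji) }
  let L : @LocallyFiniteOrder (Fin n) P.toPreorder :=
    @Fintype.toLocallyFiniteOrder (Fin n) P.toPreorder _ _ _
  exact ⟨Fin n, P, inferInstance, inferInstance, L,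
    @nonempty_algEquiv_incidenceAlgebra_of_matrix K _ A _ _ (Fin n) P _ _ L Φ hΦ e heΦ
      fun _ _ ↦ Iff.rfl⟩
end
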